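/- arXiv:1404.4155 — 4 statements merged into one kernel-verified Lean document; each statement's English description precedes it below -/
import Mathlib

section
/- Let f = h + conj(g) ∈ S_H^0 be such that Ω = f(𝔻) is an M-linearly connected domain and the dilatation ω = g'/h' satisfies |ω(z)| ≤ c for all z ∈ 𝔻, where 0 ≤ c < 1/(2M+1). Assume f extends continuously to the closed unit disk. Then there exist constants c₂ > 0 and c₃ < 2 such that for all ζ₁, ζ₂ on the unit circle, |f(ζ₁) − f(ζ₂)| ≥ c₂ |ζ₁ − ζ₂|^{c₃}. -/
open Complex Metric Set ComplexConjugate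

/-- `f = h + conj g` belongs to the class `S_H^0` of sense-preserving univalent
harmonic mappings of the unit disk normalized by `h(0) = g(0) = 0`, `h'(0) = 1`,
`g'(0) = 0`. -/
structure IsSH0 (h g : ℂ → ℂ) : Prop where
  diff_h : DifferentiableOn ℂ h (ball (0 : ℂ) 1)
  diff_g : DifferentiableOn ℂ g (ball (0 : ℂ) 1)
  sense_preserving : ∀ z ∈ ball (0 : ℂ) 1, ‖deriv g z‖ < ‖deriv h z‖
  injOn : Set.InjOn (fun z => h z + conj (g z)) (ball (0 : ℂ) 1)
  h_zero : h 0 = 0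
  g_zero : g 0 = 0
  dh_zero : deriv h 0 = 1
  dg_zero : deriv g 0 = 0

/-- A set `Ω ⊆ ℂ` is `M`-linearly connected if any two of its points can be joined by a
path in `Ω` of length at most `M` times the distance between them. -/
def LinearlyConnected (Ω : Set ℂ) (M : ℝ) : Prop :=
  ∀ z ∈ Ω, ∀ w ∈ Ω, ∃ γ : ℝ → ℂ,
    ContinuousOn γ (Set.Icc 0 1) ∧ γ 0 = z ∧ γ 1 = w ∧
    (∀ t ∈ Set.Icc (0 : ℝ) 1, γ t ∈ Ω) ∧
    eVariationOn γ (Set.Icc 0 1) ≤ ENNReal.ofReal (M * ‖z - w‖)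


open Filter Topology MeasureTheory

/-- Any two points of the unit disk are joined by a path in the disk along which `h` moves by at
most `L` times the distance of the two values. -/
def HasControlledPaths (h : ℂ → ℂ) (L : ℝ) : Prop :=
  ∀ z ∈ ball (0 : ℂ) 1, ∀ w ∈ ball (0 : ℂ) 1, ∃ γ : ℝ → ℂ,
    ContinuousOn γ (Icc 0 1) ∧ γ 0 = z ∧ γ 1 = w ∧ (∀ t ∈ Icc (0 : ℝ) 1, γ t ∈ ball (0 : ℂ) 1) ∧
    ∀ t ∈ Icc (0 : ℝ) 1, ‖h (γ t) - h z‖ ≤ L * ‖h z - h w‖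

/-- A transitive relation on a unit interval that holds for nearby points holds globally. -/
theorem rel_zero_of_local {P : ℝ → ℝ → Prop} (hrefl : P 0 0)
    (htrans : ∀ x ∈ Icc (0 : ℝ) 1, ∀ y ∈ Icc (0 : ℝ) 1, x ≤ y → P 0 x → P x y → P 0 y)
    (hloc : ∀ x ∈ Icc (0 : ℝ) 1, ∃ δ > 0, ∀ s ∈ Icc (0 : ℝ) 1, ∀ t ∈ Icc (0 : ℝ) 1,
      |s - x| < δ → |t - x| < δ → s ≤ t → P s t) :
    ∀ t ∈ Icc (0 : ℝ) 1, P 0 t := by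
  choose! δ hδ hP using hloc
  have key : ∀ x ∈ Icc (0 : ℝ) 1, (∀ s ∈ Ico 0 x, P 0 s) →
      ∀ t ∈ Icc (0 : ℝ) 1, t < x + δ x → P 0 t := by
    intro x hx hs t ht htx
    rcases lt_or_ge t x with h | h
    · exact hs t ⟨ht.1, h⟩
    · set y := max 0 (x - δ x / 2) with hy
      have hδx := hδ x hx
      have hyx : y ≤ x := max_le hx.1 (by linarith)
      have hy0 : y ∈ Icc (0 : ℝ) 1 := ⟨le_max_left _ _, hyx.trans hx.2⟩
      have hyd : |y - x| < δ x := by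
        rw [abs_lt]; constructor
        · have := le_max_right 0 (x - δ x / 2); linarith
        · linarith
      have hP0 : P 0 y := by
        rcases eq_or_lt_of_le hyx with h' | h'
        · have : y = 0 := by
            rcases max_choice 0 (x - δ x / 2) with h'' | h''
            · rw [hy, h'']
            · rw [← hy] at h''; linarith
          rw [this]; exact hrefl
        · exact hs y ⟨hy0.1, h'⟩
      refine htrans y hy0 t ht (hyx.trans h) hP0 (hP x hx y hy0 t ht hyd ?_ (hyx.trans h))
      rw [abs_lt]; constructor <;> linarith
  by_contra! hcon
  obtain ⟨t₀, ht₀, hnot⟩ := hcon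
  set B : Set ℝ := {t | t ∈ Icc (0 : ℝ) 1 ∧ ¬ P 0 t} with hB
  have hBne : B.Nonempty := ⟨t₀, ht₀, hnot⟩
  have hBb : BddBelow B := ⟨0, fun t ht => ht.1.1⟩
  have hx : sInf B ∈ Icc (0 : ℝ) 1 :=
    ⟨le_csInf hBne fun t ht => ht.1.1, (csInf_le hBb ⟨ht₀, hnot⟩).trans ht₀.2⟩
  obtain ⟨t, ht, htlt⟩ := exists_lt_of_csInf_lt hBne (lt_add_of_pos_right (sInf B) (hδ _ hx))
  refine ht.2 (key _ hx (fun s hs => ?_) t ht.1 htlt)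
  by_contra hc
  exact absurd (csInf_le hBb ⟨⟨hs.1, hs.2.le.trans hx.2⟩, hc⟩) (not_le.2 hs.2)

/-- The inverse of an injective map which is open at every point is continuous. -/
theorem continuousAt_invFunOn {f : ℂ → ℂ} {U : Set ℂ} (hU : IsOpen U) (hinj : InjOn f U)
    (hopen : ∀ z ∈ U, map f (𝓝 z) = 𝓝 (f z)) {z : ℂ} (hz : z ∈ U) :
    ContinuousAt (Function.invFunOn f U) (f z) := by
  have hleft : ∀ x ∈ U, Function.invFunOn f U (f x) = x := fun x hx =>
    hinj.leftInvOn_invFunOn hx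
  rw [ContinuousAt, hleft z hz, ← hopen z hz, tendsto_map'_iff]
  refine (tendsto_id (α := ℂ)).congr' ?_
  filter_upwards [hU.mem_nhds hz] with x hx
  exact (hleft x hx).symm

theorem hasStrictFDerivAt_add_conj {h g : ℂ → ℂ} {z a b : ℂ} (hh : HasStrictDerivAt h a z)
    (hg : HasStrictDerivAt g b z) :
    ∃ A : ℂ →L[ℝ] ℂ, HasStrictFDerivAt (fun z => h z + conj (g z)) A z ∧
      ∀ v, A v = v * a + conj (v * b) := by
  have h1 := hh.hasStrictFDerivAt.restrictScalars ℝ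
  have h2 := hg.hasStrictFDerivAt.restrictScalars ℝ
  have h3 := (conjCLE.toContinuousLinearMap.hasStrictFDerivAt (x := g z)).comp z h2
  refine ⟨_, h1.add h3, fun v => ?_⟩
  simp

theorem map_nhds_add_conj {h g : ℂ → ℂ} {z a b : ℂ} (hh : HasStrictDerivAt h a z)
    (hg : HasStrictDerivAt g b z) (hab : ‖b‖ < ‖a‖) :
    map (fun z => h z + conj (g z)) (𝓝 z) = 𝓝 (h z + conj (g z)) := by
  obtain ⟨A, hA, hAv⟩ := hasStrictFDerivAt_add_conj hh hg
  refine hA.map_nhds_eq_of_surj ?_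
  have hinj : Function.Injective (A : ℂ →ₗ[ℝ] ℂ) := by
    rw [injective_iff_map_eq_zero]
    intro v hv
    have hv' : v * a + conj (v * b) = 0 := by rw [← hAv]; exact hv
    have : ‖v * a‖ = ‖v * b‖ := by
      rw [eq_neg_of_add_eq_zero_left hv', norm_neg, RCLike.norm_conj]
    rw [norm_mul, norm_mul] at this
    by_contra hne
    have := mul_left_cancel₀ (norm_ne_zero_iff.2 hne) this
    linarith
  exact LinearMap.range_eq_top.2 (LinearMap.injective_iff_surjective.1 hinj)

/-- Near a point with small dilatation, the increments of `h` dominate those of `g`. -/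
theorem eventually_norm_sub_le {h g : ℂ → ℂ} {z a b : ℂ} {c c' : ℝ} (hh : HasStrictDerivAt h a z)
    (hg : HasStrictDerivAt g b z) (ha : a ≠ 0) (hb : ‖b‖ ≤ c * ‖a‖) (hc0 : 0 ≤ c) (hc : c < c') :
    ∀ᶠ p : ℂ × ℂ in 𝓝 (z, z), ‖g p.1 - g p.2‖ ≤ c' * ‖h p.1 - h p.2‖ := by
  have ha' : 0 < ‖a‖ := norm_pos_iff.2 ha
  obtain ⟨e, he, hee⟩ : ∃ e > 0, c * ‖a‖ + e ≤ c' * (‖a‖ - e) := by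
    refine ⟨(c' - c) * ‖a‖ / (1 + c'), by
      have := sub_pos.2 hc
      have : 0 < 1 + c' := by linarith
      positivity, ?_⟩
    have : 0 < 1 + c' := by linarith
    apply le_of_eq; field_simp; ring
  have h1 := (hasStrictDerivAt_iff_hasStrictFDerivAt.1 hh).isLittleO.def he
  have h2 := (hasStrictDerivAt_iff_hasStrictFDerivAt.1 hg).isLittleO.def he
  filter_upwards [h1, h2] with p hp1 hp2
  simp only [ContinuousLinearMap.toSpanSingleton_apply, smul_eq_mul] at hp1 hp2
  have e1 : ‖g p.1 - g p.2‖ ≤ ‖p.1 - p.2‖ * ‖b‖ + e * ‖p.1 - p.2‖ := by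
    have := norm_add_le (g p.1 - g p.2 - (p.1 - p.2) * b) ((p.1 - p.2) * b)
    rw [sub_add_cancel, norm_mul] at this; linarith
  have e2 : ‖p.1 - p.2‖ * ‖a‖ ≤ ‖h p.1 - h p.2‖ + e * ‖p.1 - p.2‖ := by
    have := norm_sub_le (h p.1 - h p.2) (h p.1 - h p.2 - (p.1 - p.2) * a)
    rw [sub_sub_cancel, norm_mul] at this; linarith
  have e3 : ‖p.1 - p.2‖ * (c * ‖a‖ + e) ≤ ‖p.1 - p.2‖ * (c' * (‖a‖ - e)) := by gcongr
  have e4 : ‖p.1 - p.2‖ * ‖b‖ ≤ ‖p.1 - p.2‖ * (c * ‖a‖) := by gcongr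
  have e5 : c' * (‖p.1 - p.2‖ * ‖a‖) ≤ c' * (‖h p.1 - h p.2‖ + e * ‖p.1 - p.2‖) := by
    have : 0 ≤ c' := by linarith
    gcongr
  linarith

/-- Along a pulled back path, the increments of `h` and `g` are controlled by the length of the
image path. -/
theorem norm_sub_le_of_path {h g : ℂ → ℂ} {c' : ℝ} (hc0 : 0 ≤ c') (hc1 : c' < 1)
    {γ : ℝ → ℂ} (hγ : ContinuousOn γ (Icc 0 1))
    (hloc : ∀ t ∈ Icc (0 : ℝ) 1, ∀ᶠ p : ℂ × ℂ in 𝓝 (γ t, γ t),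
      ‖g p.1 - g p.2‖ ≤ c' * ‖h p.1 - h p.2‖) {ℓ : ℝ} (hℓ : 0 ≤ ℓ)
    (hvar : eVariationOn (fun t => h (γ t) + conj (g (γ t))) (Icc 0 1) ≤ ENNReal.ofReal ℓ) :
    ∀ t ∈ Icc (0 : ℝ) 1, ‖h (γ t) - h (γ 0)‖ ≤ ℓ / (1 - c') ∧
      ‖g (γ t) - g (γ 0)‖ ≤ c' * (ℓ / (1 - c')) := by
  set f : ℝ → ℂ := fun t => h (γ t) + conj (g (γ t)) with hf
  have hbv : LocallyBoundedVariationOn f (Icc 0 1) :=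
    BoundedVariationOn.locallyBoundedVariationOn (ne_top_of_le_ne_top ENNReal.ofReal_ne_top hvar)
  have h1c : 0 < 1 - c' := by linarith
  set V : ℝ → ℝ := variationOnFromTo f (Icc 0 1) 0 with hV
  have h0 : (0 : ℝ) ∈ Icc (0 : ℝ) 1 := ⟨le_rfl, zero_le_one⟩
  have hfV : ∀ s ∈ Icc (0 : ℝ) 1, ∀ t ∈ Icc (0 : ℝ) 1, s ≤ t → ‖f t - f s‖ ≤ V t - V s := by
    intro s hs t ht hst
    have h1 : V t - V s = variationOnFromTo f (Icc 0 1) s t := by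
      have := variationOnFromTo.add hbv h0 hs ht
      simp only [hV]; linarith
    rw [h1, variationOnFromTo.eq_of_le f _ hst, ← dist_eq_norm, dist_edist]
    refine ENNReal.toReal_mono (hbv s t hs ht) (eVariationOn.edist_le f ⟨ht, hst, le_rfl⟩
      ⟨hs, le_rfl, hst⟩)
  have main := rel_zero_of_local (P := fun s t => ‖h (γ t) - h (γ s)‖ ≤ (V t - V s) / (1 - c') ∧
      ‖g (γ t) - g (γ s)‖ ≤ c' * ((V t - V s) / (1 - c'))) (by simp) ?_ ?_
  · intro t ht
    have hVt : V t - V 0 ≤ ℓ := by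
      rw [hV, variationOnFromTo.self, sub_zero, variationOnFromTo.eq_of_le f _ ht.1]
      refine ENNReal.toReal_le_of_le_ofReal hℓ ((eVariationOn.mono f inter_subset_left).trans hvar)
    have hd : (V t - V 0) / (1 - c') ≤ ℓ / (1 - c') := by gcongr
    exact ⟨(main t ht).1.trans hd, (main t ht).2.trans (by gcongr)⟩
  · rintro x - y - - ⟨hx1, hx2⟩ ⟨hy1, hy2⟩
    have e : (V y - V 0) / (1 - c') = (V y - V x) / (1 - c') + (V x - V 0) / (1 - c') := by ring
    rw [e, mul_add]
    exact ⟨(norm_sub_le_norm_sub_add_norm_sub _ _ _).trans (add_le_add hy1 hx1),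
      (norm_sub_le_norm_sub_add_norm_sub _ _ _).trans (add_le_add hy2 hx2)⟩
  · intro x hx
    have hcont : ContinuousWithinAt γ (Icc 0 1) x := hγ x hx
    have hl := hloc x hx
    rw [nhds_prod_eq] at hl
    obtain ⟨U, hU, hUp⟩ := eventually_prod_self_iff'.1 hl
    have := hcont hU
    rw [mem_map, mem_nhdsWithin_iff] at this
    obtain ⟨δ, hδ, hsub⟩ := this
    refine ⟨δ, hδ, fun s hs t ht hsx htx hst => ?_⟩
    have hsU : γ s ∈ U := hsub ⟨by rwa [mem_ball, Real.dist_eq], hs⟩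
    have htU : γ t ∈ U := hsub ⟨by rwa [mem_ball, Real.dist_eq], ht⟩
    have e1 : ‖g (γ t) - g (γ s)‖ ≤ c' * ‖h (γ t) - h (γ s)‖ := hUp _ htU _ hsU
    have e2 := hfV s hs t ht hst
    have e3 : ‖h (γ t) - h (γ s)‖ ≤ ‖f t - f s‖ + ‖g (γ t) - g (γ s)‖ := by
      have : h (γ t) - h (γ s) = (f t - f s) - conj (g (γ t) - g (γ s)) := by
        simp only [hf, map_sub]; ring
      rw [this]
      refine (norm_sub_le _ _).trans_eq ?_
      rw [RCLike.norm_conj]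
    have e4 : ‖h (γ t) - h (γ s)‖ ≤ (V t - V s) / (1 - c') := by
      rw [le_div_iff₀ h1c]; linarith
    exact ⟨e4, e1.trans (by gcongr)⟩

theorem hasStrictDerivAt_of_differentiableOn_ball {h : ℂ → ℂ}
    (hh : DifferentiableOn ℂ h (ball (0 : ℂ) 1)) {z : ℂ} (hz : z ∈ ball (0 : ℂ) 1) :
    HasStrictDerivAt h (deriv h z) z :=
  ((hh.analyticAt (isOpen_ball.mem_nhds hz)).contDiffAt (n := 1)).hasStrictDerivAt (by simp)

/-- Linear connectivity of the image of `h + conj g` passes to `h` when the dilatation is small. -/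
theorem IsSH0.exists_hasControlledPaths {h g : ℂ → ℂ} (hf : IsSH0 h g) {M c : ℝ} (hM : 1 ≤ M)
    (hlin : LinearlyConnected ((fun z => h z + conj (g z)) '' ball (0 : ℂ) 1) M)
    (hc0 : 0 ≤ c) (hc : c < 1 / (2 * M + 1))
    (hω : ∀ z ∈ ball (0 : ℂ) 1, ‖deriv g z‖ ≤ c * ‖deriv h z‖) :
    ∃ L K : ℝ, 1 ≤ L ∧ 0 < K ∧ HasControlledPaths h L ∧
      ∀ z ∈ ball (0 : ℂ) 1, ∀ w ∈ ball (0 : ℂ) 1,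
        ‖h z - h w‖ ≤ K * ‖h z + conj (g z) - (h w + conj (g w))‖ := by
  obtain ⟨c', hcc', hc'⟩ := exists_between hc
  set f : ℂ → ℂ := fun z => h z + conj (g z) with hfdef
  have hc'0 : 0 ≤ c' := hc0.trans hcc'.le
  have hM1 : 0 < 2 * M + 1 := by linarith
  rw [lt_div_iff₀ hM1] at hc'
  have h1c : 0 < 1 - c' := by nlinarith
  set K : ℝ := M / (1 - c') with hK
  have hK1 : 1 ≤ K := by rw [hK, le_div_iff₀ h1c]; linarith
  have hcK : c' * K ≤ 1 / 2 := by
    rw [hK, mul_div_assoc', div_le_iff₀ h1c]; linarith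
  have hopen : ∀ z ∈ ball (0 : ℂ) 1, map f (𝓝 z) = 𝓝 (f z) := fun z hz =>
    map_nhds_add_conj (hasStrictDerivAt_of_differentiableOn_ball hf.diff_h hz) (hasStrictDerivAt_of_differentiableOn_ball hf.diff_g hz)
      (hf.sense_preserving z hz)
  have main : ∀ z ∈ ball (0 : ℂ) 1, ∀ w ∈ ball (0 : ℂ) 1, ∃ γ : ℝ → ℂ,
      ContinuousOn γ (Icc 0 1) ∧ γ 0 = z ∧ γ 1 = w ∧
      (∀ t ∈ Icc (0 : ℝ) 1, γ t ∈ ball (0 : ℂ) 1) ∧ ∀ t ∈ Icc (0 : ℝ) 1,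
        ‖h (γ t) - h z‖ ≤ K * ‖f z - f w‖ ∧ ‖g (γ t) - g z‖ ≤ c' * (K * ‖f z - f w‖) := by
    intro z hz w hw
    obtain ⟨Γ, hΓc, hΓ0, hΓ1, hΓm, hΓv⟩ := hlin _ ⟨z, hz, rfl⟩ _ ⟨w, hw, rfl⟩
    set φ := Function.invFunOn f (ball (0 : ℂ) 1) with hφ
    have hleft : ∀ x ∈ ball (0 : ℂ) 1, φ (f x) = x := fun x hx =>
      hf.injOn.leftInvOn_invFunOn hx
    have hright : ∀ t ∈ Icc (0 : ℝ) 1, f (φ (Γ t)) = Γ t := fun t ht =>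
      Function.invFunOn_eq (hΓm t ht)
    have hmem : ∀ t ∈ Icc (0 : ℝ) 1, φ (Γ t) ∈ ball (0 : ℂ) 1 := fun t ht =>
      Function.invFunOn_mem (hΓm t ht)
    have hcont : ContinuousOn (fun t => φ (Γ t)) (Icc 0 1) := by
      intro t ht
      obtain ⟨x, hx, hxt⟩ := hΓm t ht
      have := continuousAt_invFunOn isOpen_ball hf.injOn hopen hx
      exact ContinuousAt.comp_continuousWithinAt (g := φ) (by rw [← hxt]; exact this) (hΓc t ht)
    have h0 : φ (Γ 0) = z := by rw [hΓ0]; exact hleft z hz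
    have h1 : φ (Γ 1) = w := by rw [hΓ1]; exact hleft w hw
    refine ⟨fun t => φ (Γ t), hcont, h0, h1, hmem, fun t ht => ?_⟩
    have hpos : 0 ≤ M * ‖f z - f w‖ := by positivity
    have hvar : eVariationOn (fun t => h (φ (Γ t)) + conj (g (φ (Γ t)))) (Icc 0 1) ≤
        ENNReal.ofReal (M * ‖f z - f w‖) := by
      rw [eVariationOn.eq_of_eqOn (f' := Γ) (fun t ht => hright t ht)]
      exact hΓv
    have := norm_sub_le_of_path hc'0 (by linarith) hcont (fun s hs => eventually_norm_sub_le
      (hasStrictDerivAt_of_differentiableOn_ball hf.diff_h (hmem s hs))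
      (hasStrictDerivAt_of_differentiableOn_ball hf.diff_g (hmem s hs))
      (norm_pos_iff.1 ((norm_nonneg _).trans_lt (hf.sense_preserving _ (hmem s hs))))
      (hω _ (hmem s hs)) hc0 hcc') hpos hvar t ht
    rw [h0] at this
    have e : M * ‖f z - f w‖ / (1 - c') = K * ‖f z - f w‖ := by rw [hK]; ring
    rw [e] at this
    exact this
  have hcomp : ∀ z ∈ ball (0 : ℂ) 1, ∀ w ∈ ball (0 : ℂ) 1,
      ‖h z - h w‖ ≤ K * ‖f z - f w‖ ∧ ‖f z - f w‖ ≤ 2 * ‖h z - h w‖ := by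
    intro z hz w hw
    obtain ⟨γ, -, -, hγ1, -, hb⟩ := main z hz w hw
    have := hb 1 ⟨zero_le_one, le_rfl⟩
    rw [hγ1, norm_sub_rev, norm_sub_rev (g w)] at this
    refine ⟨this.1, ?_⟩
    have e : f z - f w = (h z - h w) + conj (g z - g w) := by
      simp only [hfdef, map_sub]; ring
    have e2 : ‖f z - f w‖ ≤ ‖h z - h w‖ + ‖g z - g w‖ := by
      rw [e]; refine (norm_add_le _ _).trans_eq ?_; rw [RCLike.norm_conj]
    have e3 : c' * K * ‖f z - f w‖ ≤ 1 / 2 * ‖f z - f w‖ := by gcongr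
    linarith [this.2]
  refine ⟨2 * K, K, by linarith, by linarith, fun z hz w hw => ?_, fun z hz w hw => (hcomp z hz w hw).1⟩
  obtain ⟨γ, h1, h2, h3, h4, hb⟩ := main z hz w hw
  refine ⟨γ, h1, h2, h3, h4, fun t ht => (hb t ht).1.trans ?_⟩
  have := (hcomp z hz w hw).2
  nlinarith

/-- A continuous real function vanishing at `0` whose cosine stays positive stays in
`(-π / 2, π / 2)`. -/
theorem abs_lt_pi_div_two_of_cos_pos {u : ℝ → ℝ} (hu : ContinuousOn u (Icc 0 1)) (h0 : u 0 = 0)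
    (hcos : ∀ t ∈ Icc (0 : ℝ) 1, 0 < Real.cos (u t)) : |u 1| < Real.pi / 2 := by
  have hpi := Real.pi_pos
  by_contra! hcon
  have : Real.pi / 2 ∈ (fun t => |u t|) '' Icc 0 1 :=
    intermediate_value_Icc zero_le_one hu.abs ⟨by simpa [h0] using (half_pos hpi).le, hcon⟩
  obtain ⟨t, ht, hut⟩ := this
  have := hcos t ht
  rw [← Real.cos_abs, show |u t| = Real.pi / 2 from hut, Real.cos_pi_div_two] at this
  exact lt_irrefl _ this

/-- A branch of `log (h - p)` changes by the angle between nearby points on a circle about `p`. -/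
theorem log_branch_sub_eq {h q : ℂ → ℂ} {L : ℝ} (hpath : HasControlledPaths h L) {p : ℂ}
    (hq : ContinuousOn q (ball (0 : ℂ) 1)) (hexp : ∀ z ∈ ball (0 : ℂ) 1, exp (q z) = h z - p)
    {r : ℝ} (hr : 0 < r) {z w : ℂ} (hz : z ∈ ball (0 : ℂ) 1) (hw : w ∈ ball (0 : ℂ) 1) {s t : ℝ}
    (hzs : h z = p + r * exp (s * I)) (hwt : h w = p + r * exp (t * I))
    (hL : 1 ≤ L) (hst : L * |t - s| ≤ 1 / 2) : q w - q z = (t - s : ℝ) * I := by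
  obtain ⟨γ, hγc, hγ0, hγ1, hγm, hγb⟩ := hpath z hz w hw
  have hrc : (r : ℂ) ≠ 0 := by exact_mod_cast hr.ne'
  have hzp : h z - p = r * exp (s * I) := by rw [hzs]; ring
  have hzp' : h z - p ≠ 0 := by rw [hzp]; exact mul_ne_zero hrc (exp_ne_zero _)
  have hnorm : ‖h z - p‖ = r := by
    rw [hzp, norm_mul, norm_exp_ofReal_mul_I, mul_one, norm_real, Real.norm_of_nonneg hr.le]
  have hdist : ‖h z - h w‖ ≤ r * |t - s| := by
    have : h z - h w = r * exp (s * I) * (1 - exp (I * ((t - s : ℝ) : ℂ))) := by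
      rw [hzs, hwt, mul_sub, mul_assoc _ (exp _) (exp _), ← Complex.exp_add]
      push_cast; ring_nf
    rw [this, norm_mul, ← hzp, hnorm, norm_sub_rev]
    gcongr
    simpa using Real.norm_exp_I_mul_ofReal_sub_one_le (x := t - s)
  have hexpD : ∀ x ∈ Icc (0 : ℝ) 1, exp (q (γ x) - q z) = 1 + (h (γ x) - h z) / (h z - p) := by
    intro x hx
    rw [Complex.exp_sub, hexp _ (hγm x hx), hexp z hz]
    field_simp; ring
  have hsmall : ∀ x ∈ Icc (0 : ℝ) 1, ‖(h (γ x) - h z) / (h z - p)‖ ≤ 1 / 2 := by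
    intro x hx
    rw [norm_div, hnorm, div_le_iff₀ hr]
    have h1 := hγb x hx
    have h2 : L * ‖h z - h w‖ ≤ L * (r * |t - s|) := by gcongr
    nlinarith
  have hcont : ContinuousOn (fun x => (q (γ x) - q z).im) (Icc 0 1) :=
    continuous_im.comp_continuousOn ((hq.comp hγc hγm).sub continuousOn_const)
  have him := abs_lt_pi_div_two_of_cos_pos hcont (by simp [hγ0]) (fun x hx => by
    have h1 : 0 < (exp (q (γ x) - q z)).re := by
      rw [hexpD x hx, add_re, one_re]
      have := (abs_le.1 ((abs_re_le_norm _).trans (hsmall x hx))).1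
      linarith
    rw [exp_re] at h1
    exact pos_of_mul_pos_right h1 (Real.exp_pos _).le)
  rw [hγ1] at him
  have hend : exp (q w - q z) = exp ((t - s : ℝ) * I) := by
    rw [Complex.exp_sub, hexp w hw, hexp z hz, hwt, hzp, add_sub_cancel_left,
      mul_div_mul_left _ _ hrc, ← Complex.exp_sub]
    push_cast; ring_nf
  obtain ⟨n, hn⟩ := Complex.exp_eq_exp_iff_exists_int.1 hend
  have hn' : (q w - q z).im = (t - s) + n * (2 * Real.pi) := by
    rw [hn]; simp
  have habs : |t - s| ≤ 1 / 2 := by nlinarith [abs_nonneg (t - s)]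
  have hpi := Real.pi_gt_three
  have hn0 : n = 0 := by
    rw [abs_lt] at him; rw [abs_le] at habs
    have h1 : (n : ℝ) < 1 := by nlinarith
    have h2 : (-1 : ℝ) < n := by nlinarith
    have h1' : n < 1 := by exact_mod_cast h1
    have h2' : -1 < n := by exact_mod_cast h2
    omega
  rw [hn, hn0]; simp

theorem exists_log_branch {h : ℂ → ℂ} (hh : ContinuousOn h (ball (0 : ℂ) 1)) {p : ℂ}
    (hp : p ∉ h '' ball (0 : ℂ) 1) :
    ∃ q : ℂ → ℂ, ContinuousOn q (ball (0 : ℂ) 1) ∧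
      ∀ z ∈ ball (0 : ℂ) 1, exp (q z) = h z - p := by
  have hsc : IsSimplyConnected (ball (0 : ℂ) 1) := by
    have := (convex_ball (0 : ℂ) 1).contractibleSpace ⟨0, by simp⟩
    exact SimplyConnectedSpace.ofContractible _
  obtain ⟨q, hq, he⟩ := exists_continuousOn_eqOn_exp_comp hsc isOpen_ball
    (hh.sub (continuousOn_const (c := p))) (by
      rintro ⟨z, hz, hz0⟩
      exact hp ⟨z, hz, sub_eq_zero.1 hz0⟩)
  exact ⟨q, hq, fun z hz => he hz⟩

/-- Every circle centred at an omitted value contains an arc of definite angle outside the image. -/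
theorem exists_arc_disjoint_image {h : ℂ → ℂ} (hh : ContinuousOn h (ball (0 : ℂ) 1)) {L : ℝ}
    (hL : 1 ≤ L) (hpath : HasControlledPaths h L) {n : ℕ} (hn : 8 * Real.pi * L ≤ n) {p : ℂ}
    (hp : p ∉ h '' ball (0 : ℂ) 1) {r : ℝ} (hr : 0 < r) :
    ∃ k < n, ∀ s ∈ Ioo (-Real.pi + 2 * Real.pi * k / n) (-Real.pi + 2 * Real.pi * (k + 1) / n),
      p + r * exp (s * I) ∉ h '' ball (0 : ℂ) 1 := by
  obtain ⟨q, hq, hexp⟩ := exists_log_branch hh hp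
  by_contra! hcon
  have hpi := Real.pi_gt_three
  have hn0 : (0 : ℝ) < n := by nlinarith
  choose! s hs z hz hzs using hcon
  have hstep : ∀ j < n, ∀ k < n, ∀ x : ℝ, exp (x * I) = exp (s k * I) →
      |x - s j| ≤ 4 * Real.pi / n → q (z k) - q (z j) = (x - s j : ℝ) * I := by
    intro j hj k hk x hx hxs
    refine log_branch_sub_eq hpath hq hexp hr (hz j hj) (hz k hk) (hzs j hj)
      ((hzs k hk).trans (by rw [hx])) hL ?_
    calc L * |x - s j| ≤ L * (4 * Real.pi / n) := by gcongr
      _ = (8 * Real.pi * L) / (2 * n) := by field_simp; ring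
      _ ≤ n / (2 * n) := by gcongr
      _ = 1 / 2 := by field_simp
  have hsum : ∀ k < n, q (z k) - q (z 0) = (s k - s 0 : ℝ) * I := by
    intro k
    induction k with
    | zero => intro _; simp
    | succ k ih =>
      intro hk
      have hk' : k < n := by omega
      have h1 := hstep k hk' (k + 1) hk (s (k + 1)) rfl (by
        have a := hs k hk'
        have b := hs (k + 1) hk
        have e : 2 * Real.pi * ((k + 1 : ℕ) + 1 : ℝ) / n = 2 * Real.pi * k / n + 4 * Real.pi / n := by
          push_cast; field_simp; ring
        have e' : 2 * Real.pi * ((k + 1 : ℕ) : ℝ) / n = 2 * Real.pi * (k + 1) / n := by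
          push_cast; ring
        rw [e, e'] at b
        have : 0 < 4 * Real.pi / n := by positivity
        rw [abs_le]; constructor <;> linarith [a.1, a.2, b.1, b.2])
      have h2 := ih hk'
      have : q (z (k + 1)) - q (z 0) = (q (z (k + 1)) - q (z k)) + (q (z k) - q (z 0)) := by ring
      rw [this, h1, h2]; push_cast; ring
  have hnn : 0 < n := by exact_mod_cast hn0
  have hlast := hsum (n - 1) (by omega)
  have hclose := hstep (n - 1) (by omega) 0 hnn (s 0 + 2 * Real.pi) (by
      rw [show ((s 0 + 2 * Real.pi : ℝ) : ℂ) * I = s 0 * I + 2 * Real.pi * I by push_cast; ring,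
        Complex.exp_periodic]) (by
      have a := hs (n - 1) (by omega)
      have b := hs 0 hnn
      have hcast : ((n - 1 : ℕ) : ℝ) = n - 1 := by
        rw [Nat.cast_sub hnn]; simp
      have e : 2 * Real.pi * ((n - 1 : ℕ) : ℝ) / n = 2 * Real.pi - 2 * Real.pi / n := by
        rw [hcast]; field_simp
      have e' : 2 * Real.pi * (((n - 1 : ℕ) : ℝ) + 1) / n = 2 * Real.pi := by
        rw [hcast]; field_simp; ring
      rw [e, e'] at a
      have e2 : 4 * Real.pi / n = 2 * Real.pi / n + 2 * Real.pi / n := by ring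
      simp only [Nat.cast_zero, mul_zero, zero_div, add_zero, zero_add, mul_one] at b
      rw [abs_le, e2]
      constructor <;> linarith [a.1, a.2, b.1, b.2])
  have hfin : ((2 * Real.pi : ℝ) : ℂ) * I = 0 := by
    have e : ((2 * Real.pi : ℝ) : ℂ) * I = ((s 0 + 2 * Real.pi - s (n - 1) : ℝ) : ℂ) * I +
      ((s (n - 1) - s 0 : ℝ) : ℂ) * I := by push_cast; ring
    rw [e, ← hlast, ← hclose]; ring
  have := congrArg Complex.im hfin
  simp at this

/-- The angular measure of a circle about an omitted value inside the image is bounded away from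
`2 * π`. -/
theorem volume_arc_le {h : ℂ → ℂ} (hh : ContinuousOn h (ball (0 : ℂ) 1)) {L : ℝ}
    (hL : 1 ≤ L) (hpath : HasControlledPaths h L) {n : ℕ} (hn : 8 * Real.pi * L ≤ n) {p : ℂ}
    (hp : p ∉ h '' ball (0 : ℂ) 1) {r : ℝ} (hr : 0 < r) :
    volume {s : ℝ | s ∈ Ioo (-Real.pi) Real.pi ∧ p + r * exp (s * I) ∈ h '' ball (0 : ℂ) 1} ≤
      ENNReal.ofReal (2 * Real.pi - 2 * Real.pi / n) := by
  obtain ⟨k, hk, hks⟩ := exists_arc_disjoint_image hh hL hpath hn hp hr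
  have hpi := Real.pi_pos
  have hn0 : (0 : ℝ) < n := by nlinarith
  have hk1 : (k : ℝ) + 1 ≤ n := by exact_mod_cast hk
  set a : ℝ := -Real.pi + 2 * Real.pi * k / n with ha
  set b : ℝ := -Real.pi + 2 * Real.pi * (k + 1) / n with hb
  have hab : b - a = 2 * Real.pi / n := by rw [ha, hb]; field_simp; ring
  have hpa : -Real.pi ≤ a := by
    have : 0 ≤ 2 * Real.pi * k / n := by positivity
    linarith
  have hbp : b ≤ Real.pi := by
    have : 2 * Real.pi * (k + 1) / n ≤ 2 * Real.pi := by
      rw [div_le_iff₀ hn0]; gcongr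
    linarith
  have hsub : {s : ℝ | s ∈ Ioo (-Real.pi) Real.pi ∧ p + r * exp (s * I) ∈ h '' ball (0 : ℂ) 1} ⊆
      Icc (-Real.pi) a ∪ Icc b Real.pi := by
    rintro s ⟨hs, hsG⟩
    rcases le_or_gt s a with h1 | h1
    · exact Or.inl ⟨hs.1.le, h1⟩
    rcases le_or_gt b s with h2 | h2
    · exact Or.inr ⟨h2, hs.2.le⟩
    · exact absurd hsG (hks s ⟨h1, h2⟩)
  refine (measure_mono hsub).trans ((measure_union_le _ _).trans ?_)
  rw [Real.volume_Icc, Real.volume_Icc, ← ENNReal.ofReal_add (by linarith) (by linarith)]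
  exact ENNReal.ofReal_le_ofReal (by linarith)

/-- The logarithmic area of an annulus about an omitted value inside the image, pulled back
to the disk. -/
theorem lintegral_log_deriv_sq_le {h : ℂ → ℂ} (hh : DifferentiableOn ℂ h (ball (0 : ℂ) 1))
    (hinj : InjOn h (ball (0 : ℂ) 1)) {p : ℂ} {B : ℝ} (hB : 0 ≤ B)
    (harc : ∀ r : ℝ, 0 < r → volume {s : ℝ | s ∈ Ioo (-Real.pi) Real.pi ∧
      p + r * exp (s * I) ∈ h '' ball (0 : ℂ) 1} ≤ ENNReal.ofReal B)
    {k : ℝ → ℝ} {l u : ℝ} (hlu : l ≤ u) (hk0 : ∀ x, 0 ≤ k x) (hk1 : ∀ x, k x ≤ 1)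
    (hk : ∀ x, x ∉ Icc l u → k x = 0) :
    ∫⁻ z in ball (0 : ℂ) 1, ENNReal.ofReal
      ((k (Real.log ‖h z - p‖) * (‖deriv h z‖ / ‖h z - p‖)) ^ 2) ≤ ENNReal.ofReal (B * (u - l)) := by
  set G := h '' ball (0 : ℂ) 1 with hG
  set f : ℂ → ENNReal := fun w => ENNReal.ofReal ((k (Real.log ‖w - p‖) / ‖w - p‖) ^ 2) with hf
  have hder : ∀ z ∈ ball (0 : ℂ) 1, HasFDerivWithinAt h
      ((ContinuousLinearMap.toSpanSingleton ℂ (deriv h z)).restrictScalars ℝ) (ball (0 : ℂ) 1) z :=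
    fun z hz => ((hasStrictDerivAt_of_differentiableOn_ball hh
      hz).hasDerivAt.hasFDerivAt.restrictScalars ℝ).hasFDerivWithinAt
  have hdet : ∀ c : ℂ, ((ContinuousLinearMap.toSpanSingleton ℂ c).restrictScalars ℝ).det =
      ‖c‖ ^ 2 := by
    intro c
    simp [ContinuousLinearMap.det, LinearMap.det_restrictScalars, Algebra.norm_complex_eq,
      Complex.normSq_eq_norm_sq]
  have hcv := lintegral_image_eq_lintegral_abs_det_fderiv_mul volume measurableSet_ball hder hinj f
  have hle : ∀ r : ℝ, 0 < r → ∫⁻ s in Ioo (-Real.pi) Real.pi,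
      ENNReal.ofReal r * G.indicator f (p + r * exp (s * I)) ≤
        (Icc (Real.exp l) (Real.exp u)).indicator (fun r => ENNReal.ofReal (B * r⁻¹)) r := by
    intro r hr
    set A : Set ℝ := {s : ℝ | s ∈ Ioo (-Real.pi) Real.pi ∧ p + r * exp (s * I) ∈ G} with hA
    have hnorm : ∀ s : ℝ, ‖p + r * exp (s * I) - p‖ = r := by
      intro s
      rw [add_sub_cancel_left, norm_mul, norm_exp_ofReal_mul_I, mul_one, norm_real,
        Real.norm_of_nonneg hr.le]
    by_cases hrI : r ∈ Icc (Real.exp l) (Real.exp u)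
    · rw [indicator_of_mem hrI]
      calc ∫⁻ s in Ioo (-Real.pi) Real.pi, ENNReal.ofReal r * G.indicator f (p + r * exp (s * I))
          ≤ ∫⁻ s in Ioo (-Real.pi) Real.pi, (toMeasurable volume A).indicator
            (fun _ => ENNReal.ofReal r⁻¹) s := by
            refine setLIntegral_mono' measurableSet_Ioo fun s hs => ?_
            by_cases hsG : p + r * exp (s * I) ∈ G
            · have hsA : s ∈ A := ⟨hs, hsG⟩
              rw [indicator_of_mem hsG, indicator_of_mem (subset_toMeasurable volume A hsA), hf,
                ← ENNReal.ofReal_mul hr.le]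
              simp only [hnorm]
              refine ENNReal.ofReal_le_ofReal ?_
              have h1 : k (Real.log r) ^ 2 ≤ 1 := pow_le_one₀ (hk0 _) (hk1 _)
              calc r * (k (Real.log r) / r) ^ 2 = k (Real.log r) ^ 2 * r⁻¹ := by field_simp
                _ ≤ 1 * r⁻¹ := by gcongr
                _ = r⁻¹ := one_mul _
            · rw [indicator_of_notMem hsG, mul_zero]; exact zero_le
        _ ≤ ∫⁻ s, (toMeasurable volume A).indicator (fun _ => ENNReal.ofReal r⁻¹) s :=
            setLIntegral_le_lintegral _ _
        _ = ENNReal.ofReal r⁻¹ * volume A := by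
            rw [lintegral_indicator_const (measurableSet_toMeasurable _ _), measure_toMeasurable]
        _ ≤ ENNReal.ofReal r⁻¹ * ENNReal.ofReal B := by gcongr; exact harc r hr
        _ = ENNReal.ofReal (B * r⁻¹) := by
            rw [← ENNReal.ofReal_mul (by positivity), mul_comm]
    · have hlog : Real.log r ∉ Icc l u := by
        rintro ⟨h1, h2⟩
        exact hrI ⟨(Real.le_log_iff_exp_le hr).1 h1, (Real.log_le_iff_le_exp hr).1 h2⟩
      have hz : ∀ s : ℝ, ENNReal.ofReal r * G.indicator f (p + r * exp (s * I)) = 0 := by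
        intro s
        have : f (p + r * exp (s * I)) = 0 := by
          simp only [hf, hnorm, hk _ hlog]; simp
        rw [mul_eq_zero]; right
        by_cases hsG : p + r * exp (s * I) ∈ G
        · rw [indicator_of_mem hsG, this]
        · rw [indicator_of_notMem hsG]
      simp [hz]
  have hGm : MeasurableSet G := measurable_image_of_fderivWithin measurableSet_ball hder hinj
  calc ∫⁻ z in ball (0 : ℂ) 1, ENNReal.ofReal
        ((k (Real.log ‖h z - p‖) * (‖deriv h z‖ / ‖h z - p‖)) ^ 2)
      = ∫⁻ w in G, f w := by
        rw [hcv]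
        refine lintegral_congr fun z => ?_
        rw [hdet, hf, ← ENNReal.ofReal_mul (abs_nonneg _), abs_of_nonneg (by positivity)]
        congr 1; ring
    _ = ∫⁻ w, G.indicator f w := (lintegral_indicator hGm f).symm
    _ = ∫⁻ w, G.indicator f (p + w) := (lintegral_add_left_eq_self _ p).symm
    _ = ∫⁻ x in Ioi (0 : ℝ) ×ˢ Ioo (-Real.pi) Real.pi,
          ENNReal.ofReal x.1 * G.indicator f (p + x.1 * exp (x.2 * I)) := by
        rw [← Complex.lintegral_comp_polarCoord_symm, polarCoord_target]
        refine lintegral_congr fun x => ?_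
        rw [smul_eq_mul, Complex.polarCoord_symm_apply, exp_mul_I]
        simp
    _ ≤ ∫⁻ r in Ioi (0 : ℝ), ∫⁻ s in Ioo (-Real.pi) Real.pi,
          ENNReal.ofReal r * G.indicator f (p + r * exp (s * I)) := by
        rw [Measure.volume_eq_prod, ← Measure.prod_restrict]
        exact lintegral_prod_le _
    _ ≤ ∫⁻ r in Ioi (0 : ℝ),
          (Icc (Real.exp l) (Real.exp u)).indicator (fun r => ENNReal.ofReal (B * r⁻¹)) r :=
        setLIntegral_mono' measurableSet_Ioi fun r hr => hle r hr
    _ ≤ ∫⁻ r in Icc (Real.exp l) (Real.exp u), ENNReal.ofReal (B * r⁻¹) := by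
        refine (setLIntegral_le_lintegral _ _).trans_eq ?_
        rw [lintegral_indicator measurableSet_Icc]
    _ = ENNReal.ofReal (∫ r in Icc (Real.exp l) (Real.exp u), B * r⁻¹) := by
        rw [ofReal_integral_eq_lintegral_ofReal]
        · refine ContinuousOn.integrableOn_Icc (ContinuousOn.mul continuousOn_const
            (continuousOn_inv₀.mono fun r hr => ?_))
          exact ((Real.exp_pos l).trans_le hr.1).ne'
        · filter_upwards [self_mem_ae_restrict measurableSet_Icc] with r hr
          have := (Real.exp_pos l).trans_le hr.1
          simp only [Pi.zero_apply]; positivity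
    _ = ENNReal.ofReal (B * (u - l)) := by
        rw [integral_Icc_eq_integral_Ioc, ← intervalIntegral.integral_of_le (Real.exp_le_exp.2 hlu),
          intervalIntegral.integral_const_mul, integral_inv_of_pos (Real.exp_pos _)
          (Real.exp_pos _), ← Real.exp_sub, Real.log_exp]

/-- A `C¹` substitute for truncation to the interval `[l, u]`. -/
theorem exists_truncation {l u : ℝ} (hlu : l ≤ u) :
    ∃ χ k : ℝ → ℝ, Continuous k ∧ (∀ x, HasDerivAt χ (k x) x) ∧ (∀ x, 0 ≤ k x) ∧
      (∀ x, k x ≤ 1) ∧ (∀ x, x ∉ Icc l u → k x = 0) ∧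
      ∀ x ≤ l, ∀ y ≥ u, u - l - 2 ≤ χ y - χ x := by
  set k : ℝ → ℝ := fun x => max 0 (min 1 (min (x - l) (u - x))) with hk
  have hkc : Continuous k := by fun_prop
  have hk0 : ∀ x, 0 ≤ k x := fun x => le_max_left _ _
  have hd : ∀ x, HasDerivAt (fun x => ∫ t in l..x, k t) (k x) x := fun x =>
    intervalIntegral.integral_hasDerivAt_right (hkc.intervalIntegrable _ _)
      (hkc.stronglyMeasurableAtFilter _ _) hkc.continuousAt
  refine ⟨fun x => ∫ t in l..x, k t, k, hkc, hd, hk0, fun x => ?_, fun x hx => ?_,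
    fun x hx y hy => ?_⟩
  · exact max_le zero_le_one (min_le_left _ _)
  · refine max_eq_left ?_
    rw [mem_Icc, not_and_or] at hx
    refine (min_le_right _ _).trans ?_
    rcases hx with hx | hx
    · exact (min_le_left _ _).trans (by linarith)
    · exact (min_le_right _ _).trans (by linarith)
  · rw [intervalIntegral.integral_interval_sub_left (hkc.intervalIntegrable _ _)
      (hkc.intervalIntegrable _ _)]
    rcases le_or_gt (u - l) 2 with h2 | h2
    · have := intervalIntegral.integral_nonneg (μ := volume) (hx.trans (hlu.trans hy)) fun t _ => hk0 t
      linarith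
    · have h1 : ∫ t in (l + 1)..(u - 1), k t ≤ ∫ t in x..y, k t :=
        intervalIntegral.integral_mono_interval (by linarith) (by linarith) (by linarith)
          (Eventually.of_forall hk0) (hkc.intervalIntegrable _ _)
      have h3 : ∫ t in (l + 1)..(u - 1), k t = ∫ t in (l + 1)..(u - 1), (1 : ℝ) := by
        refine intervalIntegral.integral_congr fun t ht => ?_
        rw [uIcc_of_le (by linarith)] at ht
        have : min 1 (min (t - l) (u - t)) = 1 :=
          min_eq_left (le_min (by linarith [ht.1]) (by linarith [ht.2]))
        simp only [hk, this]; norm_num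
      rw [h3] at h1
      simp at h1
      linarith

/-- The point at distance `t` from `a` in direction `-e * exp (i ψ)`. -/
noncomputable def polarPoint (a e : ℂ) (t ψ : ℝ) : ℂ := a - e * (t * exp (ψ * I))

theorem continuous_polarPoint (a e : ℂ) :
    Continuous fun x : ℝ × ℝ => polarPoint a e x.1 x.2 := by
  unfold polarPoint
  fun_prop

theorem lintegral_polarPoint {V : ℂ → ENNReal} (a : ℂ) {e : ℂ} (he : ‖e‖ = 1) :
    ∫⁻ x in Ioi (0 : ℝ) ×ˢ Ioo (-Real.pi) Real.pi,
      ENNReal.ofReal x.1 * V (polarPoint a e x.1 x.2) = ∫⁻ z, V z := by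
  have hrot := (rotation ⟨e, mem_sphere_zero_iff_norm.2 he⟩).measurePreserving.lintegral_comp_emb
    (rotation ⟨e, mem_sphere_zero_iff_norm.2 he⟩).toHomeomorph.measurableEmbedding
    (fun z => V (a - z))
  change ∫⁻ z, V (a - e * z) = _ at hrot
  rw [lintegral_sub_left_eq_self] at hrot
  rw [← hrot, ← Complex.lintegral_comp_polarCoord_symm, polarCoord_target]
  refine lintegral_congr fun x => ?_
  rw [smul_eq_mul, Complex.polarCoord_symm_apply, polarPoint, exp_mul_I]
  simp

theorem lintegral_polarPoint_box_le {V : ℂ → ENNReal} (hV : Measurable V) (a : ℂ) {e : ℂ}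
    (he : ‖e‖ = 1) {r R φ₁ φ₂ m : ℝ} (hr : 0 < r) (hrR : r ≤ R) (hφ₁ : -Real.pi ≤ φ₁)
    (hφ₂ : φ₂ ≤ Real.pi) (hm : 0 < m) :
    ∫⁻ x in Ioo r R ×ˢ Ioo φ₁ φ₂, V (polarPoint a e x.1 x.2) ≤
      ENNReal.ofReal (m / 2) * (∫⁻ z, V z ^ 2) +
        ENNReal.ofReal ((φ₂ - φ₁) * Real.log (R / r) / (2 * m)) := by
  have hS : MeasurableSet (Ioo r R ×ˢ Ioo φ₁ φ₂) := measurableSet_Ioo.prod measurableSet_Ioo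
  have hP : Measurable fun x : ℝ × ℝ => V (polarPoint a e x.1 x.2) :=
    hV.comp (continuous_polarPoint a e).measurable
  have hpt : ∀ t : ℝ, 0 < t → ∀ v : ENNReal, v ≤
      ENNReal.ofReal (m / 2) * (ENNReal.ofReal t * v ^ 2) + ENNReal.ofReal (1 / (2 * m) * t⁻¹) := by
    intro t ht v
    rcases eq_or_ne v ⊤ with rfl | hv
    · have h1 : ENNReal.ofReal (m / 2) ≠ 0 := by simpa using hm
      have h2 : ENNReal.ofReal t ≠ 0 := by simpa using ht
      simp [ENNReal.mul_top h1, ENNReal.mul_top h2]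
    · lift v to NNReal using hv
      rw [← ENNReal.ofReal_coe_nnreal, ← ENNReal.ofReal_pow v.coe_nonneg, ← ENNReal.ofReal_mul ht.le,
        ← ENNReal.ofReal_mul (by positivity), ← ENNReal.ofReal_add (by positivity) (by positivity)]
      refine ENNReal.ofReal_le_ofReal ?_
      have h3 : m / 2 * (t * (v : ℝ) ^ 2) + 1 / (2 * m) * t⁻¹ - v =
          (m * t * v - 1) ^ 2 / (2 * m * t) := by field_simp; ring
      have h4 : 0 ≤ (m * t * v - 1) ^ 2 / (2 * m * t) := by positivity
      linarith
  calc ∫⁻ x in Ioo r R ×ˢ Ioo φ₁ φ₂, V (polarPoint a e x.1 x.2)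
      ≤ ∫⁻ x in Ioo r R ×ˢ Ioo φ₁ φ₂, (ENNReal.ofReal (m / 2) *
          (ENNReal.ofReal x.1 * V (polarPoint a e x.1 x.2) ^ 2) +
            ENNReal.ofReal (1 / (2 * m) * x.1⁻¹)) :=
        setLIntegral_mono' hS fun x hx => hpt x.1 (hr.trans hx.1.1) _
    _ = ENNReal.ofReal (m / 2) * (∫⁻ x in Ioo r R ×ˢ Ioo φ₁ φ₂,
          ENNReal.ofReal x.1 * V (polarPoint a e x.1 x.2) ^ 2) +
            ∫⁻ x in Ioo r R ×ˢ Ioo φ₁ φ₂, ENNReal.ofReal (1 / (2 * m) * x.1⁻¹) := by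
        have h5 : Measurable fun x : ℝ × ℝ =>
            ENNReal.ofReal x.1 * V (polarPoint a e x.1 x.2) ^ 2 :=
          measurable_fst.ennreal_ofReal.mul (hP.pow_const 2)
        rw [lintegral_add_left (h5.const_mul _), lintegral_const_mul _ h5]
    _ ≤ _ := by
        gcongr
        · rw [← lintegral_polarPoint (V := fun z => V z ^ 2) a he]
          refine lintegral_mono_set (prod_mono ?_ ?_)
          · exact fun t ht => hr.trans ht.1
          · exact Ioo_subset_Ioo hφ₁ hφ₂
        · rw [Measure.volume_eq_prod, ← Measure.prod_restrict, lintegral_prod _ (by fun_prop)]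
          simp only [lintegral_const, Measure.restrict_apply_univ, Real.volume_Ioo]
          rw [lintegral_mul_const _ (by fun_prop), ← ofReal_integral_eq_lintegral_ofReal]
          · rw [← integral_Ioc_eq_integral_Ioo, ← intervalIntegral.integral_of_le hrR,
              intervalIntegral.integral_const_mul, integral_inv_of_pos hr (hr.trans_le hrR),
              ← ENNReal.ofReal_mul]
            · refine ENNReal.ofReal_le_ofReal (le_of_eq ?_)
              field_simp
            · have : 0 ≤ Real.log (R / r) := Real.log_nonneg ((one_le_div hr).2 hrR)
              positivity
          · refine IntegrableOn.mono_set (ContinuousOn.integrableOn_Icc (μ := volume)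
              (ContinuousOn.mul continuousOn_const (continuousOn_inv₀.mono fun t ht => ?_)))
              (Ioo_subset_Icc_self)
            exact (hr.trans_le ht.1).ne'
          · filter_upwards [self_mem_ae_restrict measurableSet_Ioo] with t ht
            have := hr.trans ht.1
            simp only [Pi.zero_apply]; positivity

theorem enorm_sub_le_lintegral_enorm_fderiv {τ : ℂ → ℝ} {U : Set ℂ} (hU : IsOpen U)
    (hτ : ContDiffOn ℝ 1 τ U) {c c' : ℝ → ℂ} {x y v : ℝ} (hxy : x ≤ y)
    (hc : ContDiff ℝ 1 c) (hc' : ∀ s, HasDerivAt c (c' s) s) (hv : ∀ s, ‖c' s‖ ≤ v)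
    (hcU : ∀ s ∈ Icc x y, c s ∈ U) :
    ENNReal.ofReal |τ (c y) - τ (c x)| ≤
      ∫⁻ s in Ioo x y, ENNReal.ofReal v * U.indicator (fun z => ‖fderiv ℝ τ z‖ₑ) (c s) := by
  have h1 := enorm_sub_le_lintegral_deriv_of_contDiffOn_Icc
    (hτ.comp hc.contDiffOn hcU) hxy
  rw [← restrict_Ioo_eq_restrict_Icc] at h1
  rw [Real.enorm_eq_ofReal_abs] at h1
  refine h1.trans (setLIntegral_mono' measurableSet_Ioo fun s hs => ?_)
  have hsU := hcU s (Ioo_subset_Icc_self hs)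
  have hd : HasDerivAt (τ ∘ c) (fderiv ℝ τ (c s) (c' s)) s :=
    (((hτ.contDiffAt (hU.mem_nhds hsU)).differentiableAt one_ne_zero).hasFDerivAt).comp_hasDerivAt
      s (hc' s)
  rw [hd.deriv, indicator_of_mem hsU, mul_comm]
  refine (ContinuousLinearMap.le_opENorm _ _).trans ?_
  gcongr
  rw [← ofReal_norm]
  exact ENNReal.ofReal_le_ofReal (hv s)

theorem norm_polarPoint_sq {a e : ℂ} (he : ‖e‖ = 1) (ha : a = ‖a‖ * e) (t ψ : ℝ) :
    ‖polarPoint a e t ψ‖ ^ 2 = ‖a‖ ^ 2 + t ^ 2 - 2 * ‖a‖ * t * Real.cos ψ := by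
  have h1 : polarPoint a e t ψ = e * (‖a‖ - t * exp (ψ * I)) := by
    rw [polarPoint]; nth_rw 1 [ha]; ring
  have h2 : (‖a‖ - t * exp (ψ * I) : ℂ) =
      ((‖a‖ - t * Real.cos ψ : ℝ) : ℂ) + ((-(t * Real.sin ψ) : ℝ) : ℂ) * I := by
    rw [exp_mul_I]; push_cast; ring
  rw [h1, norm_mul, he, one_mul, ← Complex.normSq_eq_norm_sq, h2, Complex.normSq_add_mul_I]
  linear_combination t ^ 2 * Real.sin_sq_add_cos_sq ψ

theorem exists_eq_polarPoint (a : ℂ) {e z : ℂ} (he : ‖e‖ = 1) :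
    ∃ ψ ∈ Icc (-Real.pi) Real.pi, z = polarPoint a e ‖z - a‖ ψ := by
  have he0 : e ≠ 0 := norm_ne_zero_iff.1 (by rw [he]; exact one_ne_zero)
  refine ⟨arg ((a - z) / e), ⟨(neg_pi_lt_arg _).le, arg_le_pi _⟩, ?_⟩
  have h1 : ‖z - a‖ = ‖(a - z) / e‖ := by rw [norm_div, he, div_one, norm_sub_rev]
  rw [polarPoint, h1, norm_mul_exp_arg_mul_I]
  field_simp
  ring

/-- Oscillation of `τ` along the part of a circle about `a` inside the disk. -/
theorem ofReal_abs_sub_polarPoint_le {τ : ℂ → ℝ} (hτ : ContDiffOn ℝ 1 τ (ball (0 : ℂ) 1))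
    {a e : ℂ} (he : ‖e‖ = 1) (ha : a = ‖a‖ * e) {t : ℝ} (ht : 0 ≤ t) {φ ψ : ℝ}
    (hφ : φ ∈ Icc (-Real.pi) Real.pi) (hψ : ψ ∈ Icc (-Real.pi) Real.pi)
    (hφb : polarPoint a e t φ ∈ ball (0 : ℂ) 1) (hψb : polarPoint a e t ψ ∈ ball (0 : ℂ) 1) :
    ENNReal.ofReal |τ (polarPoint a e t ψ) - τ (polarPoint a e t φ)| ≤
      ENNReal.ofReal t * ∫⁻ s in Ioo (-Real.pi) Real.pi,
        (ball (0 : ℂ) 1).indicator (fun z => ‖fderiv ℝ τ z‖ₑ) (polarPoint a e t s) := by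
  wlog hle : φ ≤ ψ generalizing φ ψ
  · rw [abs_sub_comm]
    exact this hψ hφ hψb hφb (le_of_not_ge hle)
  have hc : ContDiff ℝ 1 fun s : ℝ => polarPoint a e t s := by
    unfold polarPoint
    have : ContDiff ℝ 1 fun s : ℝ => (s : ℂ) := ofRealCLM.contDiff
    fun_prop
  have hc' : ∀ s : ℝ, HasDerivAt (fun s : ℝ => polarPoint a e t s)
      (-(e * (t * (exp (s * I) * I)))) s := by
    intro s
    have h1 : HasDerivAt (fun s : ℝ => (s : ℂ) * I) I s := by
      simpa using (hasDerivAt_id s).ofReal_comp.mul_const I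
    exact (((h1.cexp.const_mul (t : ℂ)).const_mul e).const_sub a)
  have hv : ∀ s : ℝ, ‖-(e * (t * (exp (s * I) * I)))‖ ≤ t := by
    intro s
    rw [norm_neg, norm_mul, norm_mul, norm_mul, he, norm_exp_ofReal_mul_I, norm_I, norm_real,
      Real.norm_of_nonneg ht]
    simp
  have hin : ∀ s ∈ Icc φ ψ, polarPoint a e t s ∈ ball (0 : ℂ) 1 := by
    intro s hs
    rw [mem_ball_zero_iff, ← sq_lt_one_iff₀ (norm_nonneg _), norm_polarPoint_sq he ha] at hφb hψb ⊢
    have hat : 0 ≤ 2 * ‖a‖ * t := by positivity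
    have hcos : min (Real.cos φ) (Real.cos ψ) ≤ Real.cos s := by
      rcases le_or_gt 0 s with h0 | h0
      · exact (min_le_right _ _).trans (Real.cos_le_cos_of_nonneg_of_le_pi h0 hψ.2 hs.2)
      · refine (min_le_left _ _).trans ?_
        rw [← Real.cos_neg φ, ← Real.cos_neg s]
        exact Real.cos_le_cos_of_nonneg_of_le_pi (by linarith) (by linarith [hφ.1])
          (by linarith [hs.1])
    rcases min_le_iff.1 hcos with h1 | h1
    · nlinarith [mul_le_mul_of_nonneg_left h1 hat]
    · nlinarith [mul_le_mul_of_nonneg_left h1 hat]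
  refine (enorm_sub_le_lintegral_enorm_fderiv isOpen_ball hτ hle hc hc' hv hin).trans ?_
  rw [lintegral_const_mul']
  · gcongr
    · exact hφ.1
    · exact hψ.2
  · exact ENNReal.ofReal_ne_top

/-- Change of `τ` along a segment issuing from `a`. -/
theorem ofReal_abs_sub_polarPoint_ray_le {τ : ℂ → ℝ} (hτ : ContDiffOn ℝ 1 τ (ball (0 : ℂ) 1))
    {a e : ℂ} (he : ‖e‖ = 1) {t R : ℝ} (htR : t ≤ R) {ψ : ℝ}
    (hin : ∀ s ∈ Icc t R, polarPoint a e s ψ ∈ ball (0 : ℂ) 1) :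
    ENNReal.ofReal |τ (polarPoint a e R ψ) - τ (polarPoint a e t ψ)| ≤
      ∫⁻ s in Ioo t R,
        (ball (0 : ℂ) 1).indicator (fun z => ‖fderiv ℝ τ z‖ₑ) (polarPoint a e s ψ) := by
  have hc : ContDiff ℝ 1 fun s : ℝ => polarPoint a e s ψ := by
    unfold polarPoint
    have : ContDiff ℝ 1 fun s : ℝ => (s : ℂ) := ofRealCLM.contDiff
    fun_prop
  have hc' : ∀ s : ℝ, HasDerivAt (fun s : ℝ => polarPoint a e s ψ) (-(e * exp (ψ * I))) s := by
    intro s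
    have h1 : HasDerivAt (fun s : ℝ => (s : ℂ) * exp (ψ * I)) (exp (ψ * I)) s := by
      simpa using (hasDerivAt_id s).ofReal_comp.mul_const (exp (ψ * I))
    exact ((h1.const_mul e).const_sub a)
  have hv : ∀ s : ℝ, ‖-(e * exp (ψ * I))‖ ≤ 1 := by
    intro s
    rw [norm_neg, norm_mul, he, norm_exp_ofReal_mul_I, mul_one]
  simpa using enorm_sub_le_lintegral_enorm_fderiv isOpen_ball hτ htR hc hc' hv hin

/-- A capacity estimate: a function of energy `E` that is at most `m₀` at some point of every
small circle about `a` and at least `m₁` on a large disk satisfies a bound on `m₁ - m₀`. -/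
theorem sub_le_of_energy_le {τ : ℂ → ℝ} (hτ : ContDiffOn ℝ 1 τ (ball (0 : ℂ) 1)) {E : ℝ}
    (hE0 : 0 ≤ E) (hE : ∫⁻ z in ball (0 : ℂ) 1, ‖fderiv ℝ τ z‖ₑ ^ 2 ≤ ENNReal.ofReal E)
    {a : ℂ} {ψ₀ q d m₀ m₁ lam mu : ℝ} (hψ₀ : 0 < ψ₀) (hψ₀' : ψ₀ < Real.pi / 2)
    (hq : q = Real.cos ψ₀) (ha : ‖a‖ < 1) (haq : 1 - q ^ 2 / 4 ≤ ‖a‖) (hd : 0 < d) (hdq : d ≤ q)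
    (hlam : 0 < lam) (hmu : 0 < mu)
    (hlo : ∀ t ∈ Ioo 0 d, ∃ z ∈ ball (0 : ℂ) 1, ‖z - a‖ = t ∧ τ z ≤ m₀)
    (hhi : ∀ z : ℂ, ‖z‖ ≤ 1 - q ^ 2 / 4 → m₁ ≤ τ z) :
    2 * ψ₀ * (m₁ - m₀) ≤ 4 * ψ₀ * (mu / 2 * E + Real.pi * Real.log 2 / mu) +
      (lam / 2 * E + ψ₀ * Real.log (2 * q / d) / lam) := by
  have hq0 : 0 < q := hd.trans_le hdq
  have hq1 : q ≤ 1 := hq ▸ Real.cos_le_one _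
  have hq2 : q ^ 2 ≤ 1 := pow_le_one₀ hq0.le hq1
  have hα : 0 < ‖a‖ := by linarith
  set e : ℂ := a / ‖a‖ with he_def
  have he : ‖e‖ = 1 := by rw [he_def, norm_div, norm_real, norm_norm, div_self hα.ne']
  have hae : a = ‖a‖ * e := by
    rw [he_def, mul_div_cancel₀]; exact_mod_cast hα.ne'
  set V : ℂ → ENNReal := (ball (0 : ℂ) 1).indicator (fun z => ‖fderiv ℝ τ z‖ₑ) with hV_def
  have hV : Measurable V := (measurable_fderiv ℝ τ).enorm.indicator measurableSet_ball
  have hVE : ∫⁻ z, V z ^ 2 ≤ ENNReal.ofReal E := by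
    refine le_trans (le_of_eq ?_) hE
    rw [← lintegral_indicator measurableSet_ball]
    refine lintegral_congr fun z => ?_
    by_cases hz : z ∈ ball (0 : ℂ) 1
    · simp [V, hz]
    · simp [V, hz]
  have hVP : Measurable fun x : ℝ × ℝ => V (polarPoint a e x.1 x.2) :=
    hV.comp (continuous_polarPoint a e).measurable
  have hcos : ∀ ψ ∈ Ioo (-ψ₀) ψ₀, q ≤ Real.cos ψ := by
    intro ψ hψ
    rw [hq, ← Real.cos_abs ψ]
    exact Real.cos_le_cos_of_nonneg_of_le_pi (abs_nonneg _) (by linarith)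
      (abs_lt.2 hψ).le
  have hray : ∀ ψ ∈ Ioo (-ψ₀) ψ₀, ∀ t, 0 ≤ t → t ≤ q → polarPoint a e t ψ ∈ ball (0 : ℂ) 1 := by
    intro ψ hψ t ht htq
    rw [mem_ball_zero_iff, ← sq_lt_one_iff₀ (norm_nonneg _), norm_polarPoint_sq he hae]
    have h1 : t * (2 * ‖a‖ * Real.cos ψ - t) ≥ 0 := by
      refine mul_nonneg ht ?_
      nlinarith [hcos ψ hψ]
    nlinarith
  have hend : ∀ ψ ∈ Ioo (-ψ₀) ψ₀, m₁ ≤ τ (polarPoint a e q ψ) := by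
    intro ψ hψ
    refine hhi _ (abs_le_of_sq_le_sq' ?_ (by linarith)).2
    rw [norm_polarPoint_sq he hae]
    have h1 := mul_le_mul_of_nonneg_left (hcos ψ hψ) (by positivity : 0 ≤ 2 * ‖a‖ * q)
    have h2 := mul_le_mul_of_nonneg_right haq (by positivity : 0 ≤ 2 * q ^ 2)
    have h3 : ‖a‖ ^ 2 ≤ 1 := pow_le_one₀ hα.le ha.le
    nlinarith [sq_nonneg q, mul_nonneg (sq_nonneg q) (sub_nonneg.2 hq2)]
  set J : ℝ → ENNReal := fun t => ∫⁻ s in Ioo (-Real.pi) Real.pi, V (polarPoint a e t s) with hJ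
  set Z : ENNReal := ∫⁻ x in Ioo (d / 2) q ×ˢ Ioo (-ψ₀) ψ₀, V (polarPoint a e x.1 x.2) with hZ
  set X : ENNReal := ∫⁻ x in Ioo (d / 2) d ×ˢ Ioo (-Real.pi) Real.pi,
    V (polarPoint a e x.1 x.2) with hX
  have hpt : ∀ t ∈ Ioo (d / 2) d, ∀ ψ ∈ Ioo (-ψ₀) ψ₀, ENNReal.ofReal (m₁ - m₀) ≤
      ENNReal.ofReal d * J t + ∫⁻ s in Ioo (d / 2) q, V (polarPoint a e s ψ) := by
    intro t ht ψ hψ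
    have ht0 : 0 < t := by linarith [ht.1]
    obtain ⟨z, hz, hzt, hzm⟩ := hlo t ⟨ht0, ht.2⟩
    obtain ⟨φ, hφ, hzφ⟩ := exists_eq_polarPoint a (z := z) he
    rw [hzt] at hzφ
    have h1 := ofReal_abs_sub_polarPoint_le hτ he hae ht0.le hφ
      (ψ := ψ) ⟨by linarith [hψ.1, Real.pi_pos], by linarith [hψ.2, Real.pi_pos]⟩ (hzφ ▸ hz)
      (hray ψ hψ t ht0.le (ht.2.le.trans hdq))
    have h2 := ofReal_abs_sub_polarPoint_ray_le hτ (a := a) he (ht.2.le.trans hdq) (ψ := ψ)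
      fun s hs => hray ψ hψ s (ht0.le.trans hs.1) hs.2
    rw [← hzφ] at h1
    calc ENNReal.ofReal (m₁ - m₀)
        ≤ ENNReal.ofReal (|τ (polarPoint a e t ψ) - τ z| +
            |τ (polarPoint a e q ψ) - τ (polarPoint a e t ψ)|) := by
          refine ENNReal.ofReal_le_ofReal ?_
          have h3 := le_abs_self (τ (polarPoint a e t ψ) - τ z)
          have h4 := le_abs_self (τ (polarPoint a e q ψ) - τ (polarPoint a e t ψ))
          linarith [hend ψ hψ]
      _ = _ := ENNReal.ofReal_add (abs_nonneg _) (abs_nonneg _)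
      _ ≤ _ := by
          refine add_le_add (h1.trans ?_) (h2.trans ?_)
          · gcongr; exact ht.2.le
          · exact lintegral_mono_set (Ioo_subset_Ioo_left ht.1.le)
  have hψint : ∀ t ∈ Ioo (d / 2) d, ENNReal.ofReal (2 * ψ₀) * ENNReal.ofReal (m₁ - m₀) ≤
      ENNReal.ofReal (2 * ψ₀ * d) * J t + Z := by
    intro t ht
    have h1 : ∫⁻ ψ in Ioo (-ψ₀) ψ₀, ENNReal.ofReal (m₁ - m₀) ≤ ∫⁻ ψ in Ioo (-ψ₀) ψ₀,
        (ENNReal.ofReal d * J t + ∫⁻ s in Ioo (d / 2) q, V (polarPoint a e s ψ)) :=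
      setLIntegral_mono' measurableSet_Ioo fun ψ hψ => hpt t ht ψ hψ
    rw [lintegral_add_left measurable_const, lintegral_const, lintegral_const,
      Measure.restrict_apply_univ, Real.volume_Ioo, show ψ₀ - -ψ₀ = 2 * ψ₀ by ring] at h1
    rw [mul_comm]
    refine h1.trans (add_le_add (le_of_eq ?_) (le_of_eq ?_))
    · rw [ENNReal.ofReal_mul (by positivity : 0 ≤ 2 * ψ₀)]; ring
    · rw [hZ, Measure.volume_eq_prod, ← Measure.prod_restrict,
        lintegral_prod_symm _ hVP.aemeasurable]
  have hJm : Measurable J := hVP.lintegral_prod_right'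
  have htint : ENNReal.ofReal (2 * ψ₀) * ENNReal.ofReal (m₁ - m₀) ≤
      ENNReal.ofReal (4 * ψ₀) * X + Z := by
    have h1 : ∫⁻ t in Ioo (d / 2) d, ENNReal.ofReal (2 * ψ₀) * ENNReal.ofReal (m₁ - m₀) ≤
        ∫⁻ t in Ioo (d / 2) d, (ENNReal.ofReal (2 * ψ₀ * d) * J t + Z) :=
      setLIntegral_mono' measurableSet_Ioo hψint
    rw [lintegral_add_left (hJm.const_mul _), lintegral_const_mul _ hJm, lintegral_const,
      lintegral_const, Measure.restrict_apply_univ, Real.volume_Ioo,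
      show d - d / 2 = d / 2 by ring] at h1
    have h2 : ∫⁻ t in Ioo (d / 2) d, J t = X := by
      rw [hX, Measure.volume_eq_prod, ← Measure.prod_restrict,
        lintegral_prod _ hVP.aemeasurable]
    rw [h2] at h1
    have h3 : ENNReal.ofReal (2 * ψ₀ * d) = ENNReal.ofReal (4 * ψ₀) * ENNReal.ofReal (d / 2) := by
      rw [← ENNReal.ofReal_mul (by positivity)]; congr 1; ring
    have h4 : ENNReal.ofReal (d / 2) ≠ 0 := by simpa using hd
    rw [h3, mul_right_comm (ENNReal.ofReal (4 * ψ₀)), ← add_mul] at h1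
    exact (ENNReal.mul_le_mul_iff_left h4 ENNReal.ofReal_ne_top).1 h1
  have hXle : X ≤ ENNReal.ofReal (mu / 2 * E + Real.pi * Real.log 2 / mu) := by
    refine (lintegral_polarPoint_box_le hV a he (by positivity) (by linarith) le_rfl le_rfl
      hmu).trans ?_
    have hl2 := Real.log_pos one_lt_two
    rw [ENNReal.ofReal_add (by positivity) (by positivity), ENNReal.ofReal_mul (by positivity)]
    refine add_le_add (by gcongr) (ENNReal.ofReal_le_ofReal (le_of_eq ?_))
    rw [show d / (d / 2) = 2 by field_simp]
    field_simp
    ring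
  have hlog : 0 ≤ Real.log (2 * q / d) := Real.log_nonneg ((one_le_div hd).2 (by linarith))
  have hZle : Z ≤ ENNReal.ofReal (lam / 2 * E + ψ₀ * Real.log (2 * q / d) / lam) := by
    refine (lintegral_polarPoint_box_le hV a he (by positivity) (by linarith)
      (by linarith [Real.pi_pos]) (by linarith [Real.pi_pos]) hlam).trans ?_
    rw [ENNReal.ofReal_add (by positivity) (by positivity), ENNReal.ofReal_mul (by positivity)]
    refine add_le_add (by gcongr) (ENNReal.ofReal_le_ofReal (le_of_eq ?_))
    rw [show q / (d / 2) = 2 * q / d by field_simp]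
    field_simp
    ring
  have hl2 := Real.log_pos one_lt_two
  have hpi := Real.pi_pos
  have hfin : ENNReal.ofReal (2 * ψ₀ * (m₁ - m₀)) ≤
      ENNReal.ofReal (4 * ψ₀ * (mu / 2 * E + Real.pi * Real.log 2 / mu) +
      (lam / 2 * E + ψ₀ * Real.log (2 * q / d) / lam)) := by
    rw [ENNReal.ofReal_add (by positivity) (by positivity), ENNReal.ofReal_mul (by positivity),
      ENNReal.ofReal_mul (by positivity : 0 ≤ 4 * ψ₀)]
    exact htint.trans (by gcongr)
  exact (ENNReal.ofReal_le_ofReal_iff (by positivity)).1 hfin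

theorem contDiffOn_comp_log_norm_sub {h : ℂ → ℂ} (hh : DifferentiableOn ℂ h (ball (0 : ℂ) 1))
    {p : ℂ} (hp : p ∉ h '' ball (0 : ℂ) 1) {χ k : ℝ → ℝ} (hk : Continuous k)
    (hχ : ∀ x, HasDerivAt χ (k x) x) :
    ContDiffOn ℝ 1 (fun z => χ (Real.log ‖h z - p‖)) (ball (0 : ℂ) 1) := by
  have hχ1 : ContDiff ℝ 1 χ := by
    rw [contDiff_one_iff_deriv]
    refine ⟨fun x => (hχ x).differentiableAt, ?_⟩
    rwa [show deriv χ = k from funext fun x => (hχ x).deriv]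
  have hne : ∀ z ∈ ball (0 : ℂ) 1, h z - p ≠ 0 := fun z hz h0 =>
    hp ⟨z, hz, sub_eq_zero.1 h0⟩
  have h1 : ContDiffOn ℝ 1 (fun z => h z - p) (ball (0 : ℂ) 1) :=
    ((hh.contDiffOn isOpen_ball).restrict_scalars ℝ).sub contDiffOn_const
  exact hχ1.comp_contDiffOn ((h1.norm ℝ hne).log fun z hz => norm_ne_zero_iff.2 (hne z hz))

theorem norm_fderiv_comp_log_norm_sub_le {h : ℂ → ℂ}
    (hh : DifferentiableOn ℂ h (ball (0 : ℂ) 1)) {p : ℂ} (hp : p ∉ h '' ball (0 : ℂ) 1)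
    {χ k : ℝ → ℝ} (hχ : ∀ x, HasDerivAt χ (k x) x) (hk0 : ∀ x, 0 ≤ k x) {z : ℂ}
    (hz : z ∈ ball (0 : ℂ) 1) :
    ‖fderiv ℝ (fun z => χ (Real.log ‖h z - p‖)) z‖ ≤
      k (Real.log ‖h z - p‖) * (‖deriv h z‖ / ‖h z - p‖) := by
  have hne : h z - p ≠ 0 := fun h0 => hp ⟨z, hz, sub_eq_zero.1 h0⟩
  have h1 : HasFDerivAt (fun z => h z - p)
      ((ContinuousLinearMap.toSpanSingleton ℂ (deriv h z)).restrictScalars ℝ) z :=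
    ((hasStrictDerivAt_of_differentiableOn_ball hh
      hz).hasDerivAt.hasFDerivAt.restrictScalars ℝ).sub_const p
  have h2 : HasFDerivAt (fun w : ℂ => ‖w‖) (fderiv ℝ (fun w : ℂ => ‖w‖) (h z - p)) (h z - p) :=
    ((contDiffAt_norm ℝ (n := 1) hne).differentiableAt one_ne_zero).hasFDerivAt
  have h3 : ‖fderiv ℝ (fun w : ℂ => ‖w‖) (h z - p)‖ ≤ 1 := by
    simpa using norm_fderiv_le_of_lipschitz ℝ (f := fun w : ℂ => ‖w‖) (x₀ := h z - p)
      lipschitzWith_one_norm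
  have h4 := (hχ (Real.log ‖h z - p‖)).comp_hasFDerivAt z
    ((h2.comp z h1).log (norm_ne_zero_iff.2 hne))
  have h5 : ‖(ContinuousLinearMap.toSpanSingleton ℂ (deriv h z)).restrictScalars ℝ‖ =
      ‖deriv h z‖ := by
    rw [ContinuousLinearMap.norm_restrictScalars, ContinuousLinearMap.norm_toSpanSingleton]
  have h6 := (ContinuousLinearMap.opNorm_comp_le (fderiv ℝ (fun w : ℂ => ‖w‖) (h z - p))
    ((ContinuousLinearMap.toSpanSingleton ℂ (deriv h z)).restrictScalars ℝ)).trans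
    (mul_le_mul_of_nonneg_right h3 (norm_nonneg _))
  rw [h5, one_mul] at h6
  rw [show (fun z => χ (Real.log ‖h z - p‖)) =
    χ ∘ fun z => Real.log (((fun w : ℂ => ‖w‖) ∘ fun z => h z - p) z) from rfl, h4.fderiv,
    norm_smul, norm_smul, Real.norm_of_nonneg (hk0 _), norm_inv, Function.comp_apply, norm_norm,
    div_eq_inv_mul]
  gcongr
  exact hk0 _

theorem exists_le_norm_sub_of_notMem_image {h : ℂ → ℂ} (hh : ContinuousOn h (ball (0 : ℂ) 1))
    (hG : IsOpen (h '' ball (0 : ℂ) 1)) {η : ℝ} (hη : η < 1) :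
    ∃ r > 0, ∀ p ∉ h '' ball (0 : ℂ) 1, ∀ z : ℂ, ‖z‖ ≤ η → r ≤ ‖h z - p‖ := by
  have hsub : closedBall (0 : ℂ) η ⊆ ball 0 1 := closedBall_subset_ball hη
  obtain ⟨r, hr, hrG⟩ := ((isCompact_closedBall (0 : ℂ) η).image_of_continuousOn
    (hh.mono hsub)).exists_thickening_subset_open hG (image_mono hsub)
  refine ⟨r, hr, fun p hp z hz => ?_⟩
  by_contra! hlt
  refine hp (hrG (mem_thickening_iff.2 ⟨h z, ⟨z, mem_closedBall_zero_iff.2 hz, rfl⟩, ?_⟩))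
  rwa [dist_comm, dist_eq_norm]

/-- Points whose images are within `s` of an omitted value cannot meet all circles about `a` of
radius up to `d`, unless `s` is at least of order `d ^ A` with `A < 2`. -/
theorem exists_mul_rpow_le_of_circles {h : ℂ → ℂ} (hh : DifferentiableOn ℂ h (ball (0 : ℂ) 1))
    (hinj : InjOn h (ball (0 : ℂ) 1)) (hG : IsOpen (h '' ball (0 : ℂ) 1)) {L : ℝ} (hL : 1 ≤ L)
    (hpath : HasControlledPaths h L) :
    ∃ c A : ℝ, 0 < c ∧ 1 ≤ A ∧ A < 2 ∧ ∀ p ∉ h '' ball (0 : ℂ) 1, ∀ a ∈ ball (0 : ℂ) 1,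
      ∀ s d : ℝ, 0 < d → d ≤ 2 → ‖h a - p‖ ≤ s →
      (∀ t ∈ Ioo 0 d, ∃ z ∈ ball (0 : ℂ) 1, ‖z - a‖ = t ∧ ‖h z - p‖ ≤ s) → c * d ^ A ≤ s := by
  have hpi := Real.pi_gt_three
  obtain ⟨n, hn⟩ := exists_nat_ge (8 * Real.pi * L)
  have hn2 : (24 : ℝ) ≤ n := by nlinarith
  set B : ℝ := 2 * Real.pi - 2 * Real.pi / n with hB
  set ψ₀ : ℝ := Real.pi / 2 - Real.pi / (4 * n) with hψ₀
  set q : ℝ := Real.cos ψ₀ with hq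
  set δ : ℝ := 1 / (2 * (2 * n - 1)) with hδ
  have hn0 : (0 : ℝ) < n := by linarith
  have hn1 : (0 : ℝ) < 2 * n - 1 := by linarith
  have hδ0 : 0 < δ := by positivity
  have hδ1 : δ ≤ 1 / 4 := by
    rw [hδ]; exact one_div_le_one_div_of_le (by norm_num) (by linarith)
  have hpn : Real.pi / (4 * n) ≤ Real.pi / 4 := by gcongr; linarith
  have hpn0 : 0 < Real.pi / (4 * n) := by positivity
  have hψ0 : 0 < ψ₀ := by rw [hψ₀]; linarith
  have hψ1 : ψ₀ < Real.pi / 2 := by rw [hψ₀]; linarith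
  have hB0 : 0 < B := by
    rw [hB, sub_pos, div_lt_iff₀ hn0]; nlinarith
  have hBψ : B = (2 - 4 * δ) * (2 * ψ₀) := by
    rw [hB, hδ, hψ₀]; field_simp; ring
  have hq0 : 0 < q := Real.cos_pos_of_mem_Ioo ⟨by linarith, hψ1⟩
  have hq1 : q ≤ 1 := Real.cos_le_one _
  set A : ℝ := (2 - 4 * δ) / (1 - δ) with hA
  have hδ2 : 0 < 1 - δ := by linarith
  have hA1 : 1 ≤ A := by rw [hA, le_div_iff₀ hδ2]; linarith
  have hA2 : A < 2 := by rw [hA, div_lt_iff₀ hδ2]; linarith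
  set mu : ℝ := δ / (2 * B) with hmu
  have hmu0 : 0 < mu := by positivity
  set C : ℝ := (4 + 4 * Real.pi * Real.log 2 / mu) / (1 - δ) with hC
  have hC0 : 0 ≤ C := by
    have := Real.log_pos one_lt_two
    positivity
  obtain ⟨r, hr, hrG⟩ := exists_le_norm_sub_of_notMem_image hh.continuousOn hG
    (show 1 - q ^ 2 / 4 < 1 by nlinarith)
  refine ⟨r * Real.exp (-C) * 4 ^ (-A), A, by positivity, hA1, hA2,
    fun p hp a ha s d hd hd2 has hcirc => ?_⟩
  rcases le_or_gt r s with hrs | hsr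
  · calc r * Real.exp (-C) * 4 ^ (-A) * d ^ A ≤ r * 1 * 4 ^ (-A) * 4 ^ A := by
          gcongr
          · exact Real.exp_le_one_iff.2 (by linarith)
          · linarith
      _ = r := by rw [mul_one, mul_assoc, ← Real.rpow_add (by norm_num)]; simp
      _ ≤ s := hrs
  have hs0 : 0 < s := lt_of_lt_of_le
    (norm_pos_iff.2 fun h0 => hp ⟨a, ha, sub_eq_zero.1 h0⟩) has
  have haq : 1 - q ^ 2 / 4 ≤ ‖a‖ := by
    by_contra! hlt
    linarith [hrG p hp a hlt.le]
  have hls : Real.log s ≤ Real.log r := Real.log_le_log hs0 hsr.le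
  set N : ℝ := Real.log r - Real.log s with hN
  have hN0 : 0 ≤ N := by linarith
  obtain ⟨χ, k, hkc, hχ, hk0, hk1, hk, hχd⟩ := exists_truncation hls
  have hχmono : Monotone χ := monotone_of_deriv_nonneg (fun x => (hχ x).differentiableAt)
    fun x => by rw [(hχ x).deriv]; exact hk0 x
  set τ : ℂ → ℝ := fun z => χ (Real.log ‖h z - p‖) with hτ
  have hE : ∫⁻ z in ball (0 : ℂ) 1, ‖fderiv ℝ τ z‖ₑ ^ 2 ≤ ENNReal.ofReal (B * N) := by
    refine le_trans (setLIntegral_mono' measurableSet_ball fun z hz => ?_)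
      (lintegral_log_deriv_sq_le hh hinj hB0.le
        (fun ρ hρ => volume_arc_le hh.continuousOn hL hpath hn hp hρ) hls hk0 hk1 hk)
    rw [← ofReal_norm, ← ENNReal.ofReal_pow (norm_nonneg _)]
    refine ENNReal.ofReal_le_ofReal (pow_le_pow_left₀ (norm_nonneg _) ?_ 2)
    exact norm_fderiv_comp_log_norm_sub_le hh hp hχ hk0 hz
  have hd' : 0 < min d q := lt_min hd hq0
  have key := sub_le_of_energy_le (contDiffOn_comp_log_norm_sub hh hp hkc hχ)
    (mul_nonneg hB0.le hN0) hE hψ0 hψ1 hq (mem_ball_zero_iff.1 ha) haq hd' (min_le_right d q)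
    (lam := 2 * ψ₀ / B) (by positivity) hmu0 (m₀ := χ (Real.log s)) (m₁ := χ (Real.log r))
    (fun t ht => by
      obtain ⟨z, hz, hzt, hzs⟩ := hcirc t ⟨ht.1, ht.2.trans_le (min_le_left _ _)⟩
      refine ⟨z, hz, hzt, hχmono (Real.log_le_log ?_ hzs)⟩
      exact norm_pos_iff.2 fun h0 => hp ⟨z, hz, sub_eq_zero.1 h0⟩)
    (fun z hz => hχmono (Real.log_le_log hr (hrG p hp z hz)))
  have hχN : N - 2 ≤ χ (Real.log r) - χ (Real.log s) := hχd _ le_rfl _ le_rfl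
  set Λ : ℝ := Real.log (2 * q / min d q) with hΛ
  have hmain : N ≤ C + A * Λ := by
    have e1 : mu / 2 * (B * N) = δ / 4 * N := by rw [hmu]; field_simp; ring
    have e2 : 2 * ψ₀ / B / 2 * (B * N) = ψ₀ * N := by field_simp
    have e3 : ψ₀ * Λ / (2 * ψ₀ / B) = ψ₀ * ((2 - 4 * δ) * Λ) := by
      rw [hBψ]
      field_simp
    have hC' : (1 - δ) * C = 4 + 4 * Real.pi * Real.log 2 / mu := by rw [hC]; field_simp
    have hA' : (1 - δ) * A = 2 - 4 * δ := by rw [hA]; field_simp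
    rw [e1, e2, e3] at key
    have h1 : 2 * ψ₀ * (N - 2) ≤ 2 * ψ₀ * (χ (Real.log r) - χ (Real.log s)) := by gcongr
    have h2 : ψ₀ * (2 * (N - 2)) ≤ ψ₀ * (4 * (δ / 4 * N + Real.pi * Real.log 2 / mu) +
        (N + (2 - 4 * δ) * Λ)) := by linarith
    have h3 := le_of_mul_le_mul_left h2 hψ0
    have h4 : 4 * Real.pi * Real.log 2 / mu = 4 * (Real.pi * Real.log 2 / mu) := by ring
    refine le_of_mul_le_mul_left ?_ hδ2
    rw [mul_add, hC', ← mul_assoc, hA', h4]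
    linarith
  have hqd : 0 < 2 * q / min d q := by positivity
  have hdmin : 2 * q / min d q ≤ 4 / d := by
    rw [div_le_div_iff₀ hd' hd]
    rcases le_total d q with h1 | h1
    · rw [min_eq_left h1]; gcongr; linarith
    · rw [min_eq_right h1]; nlinarith
  have hfin : r / s ≤ Real.exp C * (4 / d) ^ A := by
    calc r / s = Real.exp N := by
          rw [hN, Real.exp_sub, Real.exp_log hr, Real.exp_log hs0]
      _ ≤ Real.exp (C + A * Λ) := Real.exp_le_exp.2 hmain
      _ = Real.exp C * (2 * q / min d q) ^ A := by
          rw [Real.exp_add, Real.rpow_def_of_pos hqd, mul_comm A]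
      _ ≤ _ := by gcongr
  rw [div_le_iff₀ hs0, Real.div_rpow (by norm_num) hd.le] at hfin
  have hdA : 0 < d ^ A := by positivity
  have h4A : 0 < (4 : ℝ) ^ A := by positivity
  rw [Real.exp_neg, Real.rpow_neg (by norm_num)]
  calc r * (Real.exp C)⁻¹ * (4 ^ A)⁻¹ * d ^ A
      ≤ Real.exp C * (4 ^ A / d ^ A) * s * (Real.exp C)⁻¹ * (4 ^ A)⁻¹ * d ^ A := by gcongr
    _ = s := by field_simp

theorem exists_norm_sub_eq_of_path {γ : ℝ → ℂ} (hγ : ContinuousOn γ (Icc 0 1)) {t : ℝ}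
    (ht : t ∈ Icc 0 ‖γ 1 - γ 0‖) : ∃ x ∈ Icc (0 : ℝ) 1, ‖γ x - γ 0‖ = t := by
  have h1 : ContinuousOn (fun x => ‖γ x - γ 0‖) (Icc 0 1) := (hγ.sub continuousOn_const).norm
  have h2 := intermediate_value_Icc zero_le_one h1
  simp only [sub_self, norm_zero] at h2
  exact h2 ht

theorem HasControlledPaths.injOn {h : ℂ → ℂ} {L : ℝ} (hpath : HasControlledPaths h L)
    (hh : DifferentiableOn ℂ h (ball (0 : ℂ) 1)) (hd : ∀ z ∈ ball (0 : ℂ) 1, deriv h z ≠ 0) :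
    InjOn h (ball (0 : ℂ) 1) := by
  intro z hz w hw hzw
  by_contra hne
  obtain ⟨γ, hγ, h0, h1, -, hγL⟩ := hpath z hz w hw
  have hev := (hasStrictDerivAt_of_differentiableOn_ball hh hz).hasDerivAt.eventually_ne
    (hd z hz) (c := h z)
  rw [eventually_nhdsWithin_iff, Metric.eventually_nhds_iff] at hev
  obtain ⟨r, hr, hev⟩ := hev
  have hwz : 0 < ‖w - z‖ := norm_pos_iff.2 (sub_ne_zero.2 (Ne.symm hne))
  obtain ⟨x, hx, hxt⟩ := exists_norm_sub_eq_of_path hγ (t := min (r / 2) ‖w - z‖)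
    ⟨by positivity, by rw [h0, h1]; exact min_le_right _ _⟩
  rw [h0] at hxt
  have hpos : 0 < ‖γ x - z‖ := by rw [hxt]; positivity
  refine hev (y := γ x) ?_ (sub_ne_zero.1 (norm_pos_iff.1 hpos)) ?_
  · rw [dist_eq_norm, hxt]
    exact (min_le_left _ _).trans_lt (by linarith)
  · have h2 := hγL x hx
    rw [hzw, sub_self, norm_zero, mul_zero, norm_le_zero_iff, sub_eq_zero] at h2
    rw [h2, hzw]

/-- A conformal map of the disk onto a domain with controlled paths has a Hölder continuous
inverse of exponent `1 / A > 1 / 2`. -/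
theorem HasControlledPaths.exists_mul_rpow_le_norm_sub {h : ℂ → ℂ} {L : ℝ} (hL : 1 ≤ L)
    (hpath : HasControlledPaths h L) (hh : DifferentiableOn ℂ h (ball (0 : ℂ) 1))
    (hd : ∀ z ∈ ball (0 : ℂ) 1, deriv h z ≠ 0) (hne : (h '' ball (0 : ℂ) 1)ᶜ.Nonempty) :
    ∃ c A : ℝ, 0 < c ∧ 1 ≤ A ∧ A < 2 ∧ ∀ z ∈ ball (0 : ℂ) 1, ∀ w ∈ ball (0 : ℂ) 1,
      c * ‖z - w‖ ^ A ≤ ‖h z - h w‖ := by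
  have hinj := hpath.injOn hh hd
  have hmap : ∀ z ∈ ball (0 : ℂ) 1, map h (𝓝 z) = 𝓝 (h z) := fun z hz =>
    (hasStrictDerivAt_of_differentiableOn_ball hh hz).map_nhds_eq (hd z hz)
  have hG : IsOpen (h '' ball (0 : ℂ) 1) := by
    rw [isOpen_iff_mem_nhds]
    rintro _ ⟨z, hz, rfl⟩
    rw [← hmap z hz]
    exact image_mem_map (isOpen_ball.mem_nhds hz)
  obtain ⟨c, A, hc, hA1, hA2, hB⟩ := exists_mul_rpow_le_of_circles hh hinj hG hL hpath
  have hA0 : 0 < A := by linarith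
  have hcurve : ∀ p ∉ h '' ball (0 : ℂ) 1, ∀ s : ℝ, ∀ γ : ℝ → ℂ, ContinuousOn γ (Icc 0 1) →
      (∀ x ∈ Icc (0 : ℝ) 1, γ x ∈ ball (0 : ℂ) 1) → (∀ x ∈ Icc (0 : ℝ) 1, ‖h (γ x) - p‖ ≤ s) →
      c * ‖γ 1 - γ 0‖ ^ A ≤ s := by
    intro p hp s γ hγ hγb hγs
    have m0 : (0 : ℝ) ∈ Icc (0 : ℝ) 1 := by simp
    have m1 : (1 : ℝ) ∈ Icc (0 : ℝ) 1 := by simp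
    rcases (norm_nonneg (γ 1 - γ 0)).eq_or_lt with h0 | h0
    · rw [← h0, Real.zero_rpow hA0.ne', mul_zero]
      exact (norm_nonneg _).trans (hγs 0 m0)
    · refine hB p hp (γ 0) (hγb 0 m0) s _ h0 ?_ (hγs 0 m0) fun t ht => ?_
      · have h1 := mem_ball_zero_iff.1 (hγb 1 m1)
        have h2 := mem_ball_zero_iff.1 (hγb 0 m0)
        linarith [norm_sub_le (γ 1) (γ 0)]
      · obtain ⟨x, hx, hxt⟩ := exists_norm_sub_eq_of_path hγ ⟨ht.1.le, ht.2.le⟩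
        exact ⟨γ x, hγb x hx, hxt, hγs x hx⟩
  refine ⟨c / (L + 12), A, by positivity, hA1, hA2, fun z hz w hw => ?_⟩
  rcases eq_or_ne z w with rfl | hzw
  · simp [Real.zero_rpow hA0.ne']
  set ε := ‖h z - h w‖ with hε
  have hε0 : 0 < ε := norm_pos_iff.2 (sub_ne_zero.2 fun h0 => hzw (hinj hz hw h0))
  suffices hsuff : c * ‖z - w‖ ^ A ≤ (L + 12) * ε by
    rw [div_mul_eq_mul_div, div_le_iff₀ (by linarith)]
    linarith
  set ρ := infDist (h z) (h '' ball (0 : ℂ) 1)ᶜ with hρ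
  rcases le_or_gt ρ (2 * ε) with hnear | hfar
  · obtain ⟨p, hp, hzp⟩ := (infDist_lt_iff hne).1 (show ρ < 3 * ε by linarith)
    rw [dist_eq_norm] at hzp
    obtain ⟨γ, hγ, h0, h1, hγb, hγL⟩ := hpath z hz w hw
    have h2 := hcurve p hp ((L + 3) * ε) γ hγ hγb fun x hx => by
      have h3 := norm_add_le (h (γ x) - h z) (h z - p)
      rw [sub_add_sub_cancel] at h3
      linarith [hγL x hx]
    rw [h0, h1, norm_sub_rev] at h2
    nlinarith
  · have hρ0 : 0 < ρ := by linarith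
    set φ := Function.invFunOn h (ball (0 : ℂ) 1) with hφ
    have hsub : ball (h z) ρ ⊆ h '' ball (0 : ℂ) 1 := ball_infDist_compl_subset
    have hφh : ∀ x ∈ ball (0 : ℂ) 1, φ (h x) = x := fun x hx => hinj.leftInvOn_invFunOn hx
    have hφb : ∀ v ∈ h '' ball (0 : ℂ) 1, φ v ∈ ball (0 : ℂ) 1 ∧ h (φ v) = v := by
      rintro _ ⟨x, hx, rfl⟩
      rw [hφh x hx]
      exact ⟨hx, rfl⟩
    have hφd : DifferentiableOn ℂ φ (h '' ball (0 : ℂ) 1) := by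
      rintro _ ⟨x, hx, rfl⟩
      refine (HasDerivAt.of_local_left_inverse (f := h) (f' := deriv h x)
        (continuousAt_invFunOn isOpen_ball hinj hmap hx) ?_ (hd x hx)
        ?_).differentiableAt.differentiableWithinAt
      · rw [← hφ, hφh x hx]
        exact (hasStrictDerivAt_of_differentiableOn_ball hh hx).hasDerivAt
      · filter_upwards [hG.mem_nhds ⟨x, hx, rfl⟩] with v hv using (hφb v hv).2
    obtain ⟨p, hp, hzp⟩ := (infDist_lt_iff hne).1 (show ρ < 2 * ρ by linarith)
    rw [dist_eq_norm] at hzp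
    set R : ℝ := (3 * ρ / c) ^ (1 / A) with hR
    have hmaps : MapsTo φ (ball (h z) ρ) (closedBall (φ (h z)) R) := by
      intro v hv
      have hseg : ∀ x ∈ Icc (0 : ℝ) 1, h z + x * (v - h z) ∈ ball (h z) ρ := by
        intro x hx
        rw [mem_ball, dist_eq_norm, add_sub_cancel_left, norm_mul, norm_real,
          Real.norm_of_nonneg hx.1]
        rw [mem_ball, dist_eq_norm] at hv
        nlinarith [norm_nonneg (v - h z), hx.2]
      have h2 := hcurve p hp (3 * ρ) (fun x => φ (h z + x * (v - h z)))
        (hφd.continuousOn.comp (by fun_prop) fun x hx => hsub (hseg x hx))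
        (fun x hx => (hφb _ (hsub (hseg x hx))).1) fun x hx => by
          rw [(hφb _ (hsub (hseg x hx))).2]
          have h3 := hseg x hx
          rw [mem_ball, dist_eq_norm] at h3
          have h4 := norm_add_le (h z + x * (v - h z) - h z) (h z - p)
          rw [sub_add_sub_cancel] at h4
          linarith
      simp only [ofReal_one, one_mul, ofReal_zero, zero_mul, add_zero, add_sub_cancel] at h2
      rw [mem_closedBall, dist_eq_norm, hR,
        one_div, Real.le_rpow_inv_iff_of_pos (norm_nonneg _) (by positivity) hA0, le_div_iff₀ hc]
      linarith
    have hwz : h w ∈ ball (h z) ρ := by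
      rw [mem_ball, dist_comm, dist_eq_norm]; linarith
    have hS := Complex.dist_le_div_mul_dist_of_mapsTo_ball (hφd.mono hsub) hmaps hwz
    rw [hφh w hw, hφh z hz, dist_comm w, dist_comm (h w), dist_eq_norm, dist_eq_norm] at hS
    have hRA : R ^ A = 3 * ρ / c := by
      rw [hR, ← Real.rpow_mul (by positivity), one_div_mul_cancel hA0.ne', Real.rpow_one]
    have hερ : (ε / ρ) ^ A ≤ ε / ρ := by
      have h5 : ε / ρ ≤ 1 := (div_le_one hρ0).2 (by linarith)
      simpa using Real.rpow_le_rpow_of_exponent_ge (by positivity) h5 hA1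
    have hR0 : 0 ≤ R := by positivity
    calc c * ‖z - w‖ ^ A ≤ c * (R / ρ * ε) ^ A := by gcongr
      _ = c * (R ^ A * (ε / ρ) ^ A) := by
          rw [← Real.mul_rpow hR0 (by positivity)]; congr 2; ring
      _ ≤ c * (3 * ρ / c * (ε / ρ)) := by rw [hRA]; gcongr
      _ = 3 * ε := by field_simp
      _ ≤ (L + 12) * ε := by nlinarith

/-- If `f = h + conj g ∈ S_H^0` has `M`-linearly connected image, dilatation bounded by
`c < 1/(2M+1)`, and a continuous extension `F` to the closed disk, then there are
constants `c₂ > 0` and `c₃ < 2` such that `|F(ζ₁) - F(ζ₂)| ≥ c₂|ζ₁ - ζ₂|^{c₃}` for all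
`ζ₁, ζ₂` on the unit circle. -/
theorem boundary_Hoelder_lower_bound
    (h g : ℂ → ℂ) (hf : IsSH0 h g) (M c : ℝ) (hM : 1 ≤ M)
    (hlin : LinearlyConnected ((fun z => h z + conj (g z)) '' ball (0 : ℂ) 1) M)
    (hc0 : 0 ≤ c) (hc : c < 1 / (2 * M + 1))
    (hω : ∀ z ∈ ball (0 : ℂ) 1, ‖deriv g z‖ ≤ c * ‖deriv h z‖)
    (F : ℂ → ℂ) (hF : ContinuousOn F (closedBall (0 : ℂ) 1))
    (hFf : ∀ z ∈ ball (0 : ℂ) 1, F z = h z + conj (g z)) :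
    ∃ c₂ : ℝ, 0 < c₂ ∧ ∃ c₃ : ℝ, c₃ < 2 ∧
      ∀ ζ₁ ∈ sphere (0 : ℂ) 1, ∀ ζ₂ ∈ sphere (0 : ℂ) 1,
        c₂ * ‖ζ₁ - ζ₂‖ ^ c₃ ≤ ‖F ζ₁ - F ζ₂‖ := by
  obtain ⟨L, K, hL, hK, hpath, hKf⟩ := hf.exists_hasControlledPaths hM hlin hc0 hc hω
  have hd : ∀ z ∈ ball (0 : ℂ) 1, deriv h z ≠ 0 := fun z hz =>
    norm_pos_iff.1 ((norm_nonneg _).trans_lt (hf.sense_preserving z hz))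
  have h0 : (0 : ℂ) ∈ ball (0 : ℂ) 1 := by simp
  have hne : (h '' ball (0 : ℂ) 1)ᶜ.Nonempty := by
    obtain ⟨C, hC⟩ := (isCompact_closedBall (0 : ℂ) 1).exists_bound_of_continuousOn hF
    refine ⟨((K * C + 1 : ℝ) : ℂ), ?_⟩
    rintro ⟨z, hz, hzC⟩
    have h1 := hKf z hz 0 h0
    rw [hf.h_zero, hf.g_zero, ← hFf z hz, map_zero, add_zero, sub_zero, sub_zero, hzC] at h1
    have h2 : K * ‖F z‖ ≤ K * C := by gcongr; exact hC z (ball_subset_closedBall hz)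
    rw [norm_real, Real.norm_eq_abs] at h1
    linarith [le_abs_self (K * C + 1)]
  obtain ⟨c₂, A, hc₂, hA1, hA2, hlow⟩ := hpath.exists_mul_rpow_le_norm_sub hL hf.diff_h hd hne
  refine ⟨c₂ / K, by positivity, A, hA2, fun ζ₁ hζ₁ ζ₂ hζ₂ => ?_⟩
  have hmem : ∀ ζ ∈ sphere (0 : ℂ) 1, ∀ r ∈ Ico (0 : ℝ) 1, (r : ℂ) * ζ ∈ ball (0 : ℂ) 1 := by
    intro ζ hζ r hr
    rw [mem_ball_zero_iff, norm_mul, mem_sphere_zero_iff_norm.1 hζ, norm_real,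
      Real.norm_of_nonneg hr.1, mul_one]
    exact hr.2
  have hr1 : Ico (0 : ℝ) 1 ∈ 𝓝[<] (1 : ℝ) := Ico_mem_nhdsLT zero_lt_one
  have hlim : ∀ ζ : ℂ, Tendsto (fun r : ℝ => (r : ℂ) * ζ) (𝓝[<] 1) (𝓝 ζ) := by
    intro ζ
    have h1 : Continuous fun r : ℝ => (r : ℂ) * ζ := by fun_prop
    simpa using h1.continuousWithinAt (s := Iio 1) (x := 1) |>.tendsto
  have hFlim : ∀ ζ ∈ sphere (0 : ℂ) 1,
      Tendsto (fun r : ℝ => F ((r : ℂ) * ζ)) (𝓝[<] 1) (𝓝 (F ζ)) := by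
    intro ζ hζ
    refine (hF ζ (sphere_subset_closedBall hζ)).tendsto.comp
      (tendsto_nhdsWithin_iff.2 ⟨hlim ζ, ?_⟩)
    filter_upwards [hr1] with r hr using ball_subset_closedBall (hmem ζ hζ r hr)
  refine le_of_tendsto_of_tendsto
    ((((hlim ζ₁).sub (hlim ζ₂)).norm.rpow_const (Or.inr (by linarith))).const_mul (c₂ / K))
    ((hFlim ζ₁ hζ₁).sub (hFlim ζ₂ hζ₂)).norm ?_
  filter_upwards [hr1] with r hr
  have hz := hmem ζ₁ hζ₁ r hr
  have hw := hmem ζ₂ hζ₂ r hr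
  rw [div_mul_eq_mul_div, div_le_iff₀ hK, hFf _ hz, hFf _ hw, mul_comm _ K]
  exact (hlow _ hz _ hw).trans (hKf _ hz _ hw)
end

section
/- Let h and g be holomorphic on the unit disk 𝔻, let M* ≥ 1 and 0 ≤ M₁ < 1/(1 + M*). Suppose F = h − g is univalent on 𝔻, F(𝔻) is an M*-linearly connected domain, and |g'(z)| ≤ M₁ |h'(z)| for all z ∈ 𝔻. Then h is univalent on 𝔻 and h(𝔻) is an (M*/(1 − M₁(1 + M*)))-linearly connected domain. -/
open Complex Metric Set

open Filter Topology
open scoped NNReal ENNReal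

section InverseOfUnivalent

variable {F ψ : ℂ → ℂ} {U : Set ℂ} {z : ℂ}

/-- A univalent function is open at every point. -/
theorem nhds_le_map_nhds_of_injOn (hU : IsOpen U) (hF : DifferentiableOn ℂ F U)
    (hinj : InjOn F U) (hz : z ∈ U) : 𝓝 (F z) ≤ map F (𝓝 z) := by
  refine (hF.analyticAt (hU.mem_nhds hz)).eventually_constant_or_nhds_le_map_nhds.resolve_left
    fun hconst => ?_
  have hmem : ∀ᶠ w in 𝓝[≠] z, F w = F z ∧ w ∈ U :=
    (hconst.and (hU.mem_nhds hz)).filter_mono nhdsWithin_le_nhds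
  obtain ⟨w, ⟨hw, hwU⟩, hne⟩ := (hmem.and self_mem_nhdsWithin).exists
  exact hne (hinj hwU hz hw)

theorem continuousAt_leftInverse_of_injOn (hU : IsOpen U) (hF : DifferentiableOn ℂ F U)
    (hinj : InjOn F U) (hψ : LeftInvOn ψ F U) (hz : z ∈ U) : ContinuousAt ψ (F z) := by
  have hψF : ψ ∘ F =ᶠ[𝓝 z] id := by
    filter_upwards [hU.mem_nhds hz] with w hw using hψ hw
  have h : Tendsto (ψ ∘ F) (𝓝 z) (𝓝 (ψ (F z))) := by
    rw [hψ hz]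
    exact tendsto_id.congr' hψF.symm
  exact (tendsto_map'_iff.2 h).mono_left (nhds_le_map_nhds_of_injOn hU hF hinj hz)

theorem hasDerivAt_leftInverse (hU : IsOpen U) (hF : DifferentiableOn ℂ F U)
    (hψ : LeftInvOn ψ F U) (hz : z ∈ U) (hF' : deriv F z ≠ 0) :
    HasDerivAt ψ (deriv F z)⁻¹ (F z) := by
  have hleft : ∀ᶠ w in 𝓝 z, ψ (F w) = w := by
    filter_upwards [hU.mem_nhds hz] with w hw using hψ hw
  exact ((hF.analyticAt (hU.mem_nhds hz)).hasStrictDerivAt.to_local_left_inverse hF'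
    hleft).hasDerivAt

/-- The derivative of a univalent function has no zeros. -/
theorem deriv_ne_zero_of_injOn (hU : IsOpen U) (hF : DifferentiableOn ℂ F U)
    (hinj : InjOn F U) (hz : z ∈ U) : deriv F z ≠ 0 := by
  have han : AnalyticOnNhd ℂ F U := hF.analyticOnNhd hU
  have hψ : LeftInvOn (Function.invFunOn F U) F U := hinj.leftInvOn_invFunOn
  set ψ := Function.invFunOn F U
  have hcont : ContinuousAt ψ (F z) := continuousAt_leftInverse_of_injOn hU hF hinj hψ hz
  have hopen := nhds_le_map_nhds_of_injOn hU hF hinj hz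
  have hisol : ∀ᶠ w in 𝓝[≠] z, deriv F w ≠ 0 := by
    refine (han z hz).deriv.eventually_eq_zero_or_eventually_ne_zero.resolve_left fun h0 => ?_
    obtain ⟨r, hr, hball⟩ := Metric.eventually_nhds_iff_ball.1 (h0.and (hU.mem_nhds hz))
    obtain ⟨w, hw, hne⟩ : ∃ w ∈ ball z r, w ≠ z := by
      have : ∀ᶠ w in 𝓝[≠] z, w ∈ ball z r :=
        nhdsWithin_le_nhds (ball_mem_nhds z hr)
      obtain ⟨w, hw, hne⟩ := (this.and self_mem_nhdsWithin).exists
      exact ⟨w, hw, hne⟩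
    refine hne (hinj (hball w hw).2 hz ?_)
    exact isOpen_ball.is_const_of_deriv_eq_zero (convex_ball z r).isPreconnected
      (hF.mono fun x hx => (hball x hx).2) (fun x hx => (hball x hx).1) hw
      (mem_ball_self hr)
  have hpunct : ∀ᶠ w in 𝓝[≠] F z, DifferentiableAt ℂ ψ w := by
    rw [eventually_nhdsWithin_iff] at hisol ⊢
    refine hopen (Filter.mem_map.2 ?_)
    filter_upwards [hisol, hU.mem_nhds hz] with w hw hwU hne
    exact (hasDerivAt_leftInverse hU hF hψ hwU
      (hw fun h => hne (congrArg F h))).differentiableAt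
  have hψ' : DifferentiableAt ℂ ψ (F z) :=
    (analyticAt_of_differentiable_on_punctured_nhds_of_continuousAt hpunct hcont).differentiableAt
  have hid : HasDerivAt (ψ ∘ F) 1 z := by
    refine (hasDerivAt_id z).congr_of_eventuallyEq ?_
    filter_upwards [hU.mem_nhds hz] with w hw using hψ hw
  have hchain := (hψ'.hasDerivAt.comp z (han z hz).differentiableAt.hasDerivAt).unique hid
  exact right_ne_zero_of_mul_eq_one hchain

theorem isOpen_image_of_injOn (hU : IsOpen U) (hF : DifferentiableOn ℂ F U)
    (hinj : InjOn F U) : IsOpen (F '' U) := by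
  rw [isOpen_iff_mem_nhds]
  rintro _ ⟨z, hz, rfl⟩
  exact nhds_le_map_nhds_of_injOn hU hF hinj hz (image_mem_map (hU.mem_nhds hz))

end InverseOfUnivalent

section PathLength

/-- A holomorphic function whose derivative is bounded by `C` increases the length of a path by
a factor of at most `C`. -/
theorem eVariationOn_comp_le_of_nnnorm_deriv_le {f : ℂ → ℂ} {Ω : Set ℂ} {C : ℝ≥0}
    (hΩ : IsOpen Ω) (hf : ∀ w ∈ Ω, DifferentiableAt ℂ f w) (hC : ∀ w ∈ Ω, ‖deriv f w‖₊ ≤ C)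
    {γ : ℝ → ℂ} {a b : ℝ} (hab : a ≤ b) (hγ : ContinuousOn γ (Icc a b))
    (hγΩ : MapsTo γ (Icc a b) Ω) :
    eVariationOn (f ∘ γ) (Icc a b) ≤ C * eVariationOn γ (Icc a b) := by
  let B := {p : ℂ × ℝ // ball p.1 p.2 ⊆ Ω}
  obtain ⟨t, ht0, htmono, ⟨m, hm⟩, htsub⟩ := exists_monotone_Icc_subset_open_cover_Icc hab
    (c := fun p : B => (Icc a b).domRestrict γ ⁻¹' ball p.1.1 p.1.2)
    (fun p => isOpen_ball.preimage hγ.domRestrict) (fun s _ => by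
      obtain ⟨r, hr, hball⟩ := Metric.isOpen_iff.1 hΩ _ (hγΩ s.2)
      exact mem_iUnion.2 ⟨⟨(γ s, r), hball⟩, mem_ball_self hr⟩)
  have htmono' : Monotone fun n => (t n : ℝ) := fun i j hij => htmono hij
  have hsum : ∀ u : ℝ → ℂ, ∑ i ∈ Finset.range m, eVariationOn u (Icc (t i : ℝ) (t (i + 1))) =
      eVariationOn u (Icc a b) := fun u => by
    rw [eVariationOn.sum' u htmono', ht0, hm m le_rfl]
  rw [← hsum, ← hsum, Finset.mul_sum]
  refine Finset.sum_le_sum fun i _ => ?_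
  obtain ⟨⟨⟨c, r⟩, hball⟩, hi⟩ := htsub i
  refine ((convex_ball c r).lipschitzOnWith_of_nnnorm_deriv_le (fun w hw => hf w (hball hw))
    fun w hw => hC w (hball hw)).comp_eVariationOn_le fun s hs => ?_
  exact hi (show (⟨s, (t i).2.1.trans hs.1, hs.2.trans (t (i + 1)).2.2⟩ : Icc a b) ∈
    Icc (t i) (t (i + 1)) from hs)

end PathLength

/-- A perturbation `w + G w` of the identity on an `M`-linearly connected domain, with
`|G'| ≤ k` and `k M < 1`, is univalent and has a linearly connected image. -/
theorem LinearlyConnected.injOn_id_add {Ω : Set ℂ} {M : ℝ} {k : ℝ≥0} {G : ℂ → ℂ}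
    (hΩ : IsOpen Ω) (hM : 0 ≤ M) (hlin : LinearlyConnected Ω M)
    (hG : ∀ w ∈ Ω, DifferentiableAt ℂ G w) (hk : ∀ w ∈ Ω, ‖deriv G w‖₊ ≤ k)
    (hkM : k * M < 1) :
    InjOn (fun w => w + G w) Ω ∧
    LinearlyConnected ((fun w => w + G w) '' Ω) ((1 + k) * M / (1 - k * M)) := by
  have hlower : ∀ z ∈ Ω, ∀ w ∈ Ω, (1 - k * M) * ‖z - w‖ ≤ ‖(z + G z) - (w + G w)‖ := by
    intro z hz w hw
    obtain ⟨γ, hγc, hγ0, hγ1, hγΩ, hlen⟩ := hlin z hz w hw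
    have hdist : edist (G z) (G w) ≤ ENNReal.ofReal (k * (M * ‖z - w‖)) := by
      calc edist (G z) (G w) = edist ((G ∘ γ) 0) ((G ∘ γ) 1) := by simp [hγ0, hγ1]
        _ ≤ eVariationOn (G ∘ γ) (Icc 0 1) := eVariationOn.edist_le _ (by simp) (by simp)
        _ ≤ k * eVariationOn γ (Icc 0 1) :=
          eVariationOn_comp_le_of_nnnorm_deriv_le hΩ hG hk zero_le_one hγc hγΩ
        _ ≤ k * ENNReal.ofReal (M * ‖z - w‖) := by gcongr
        _ = ENNReal.ofReal (k * (M * ‖z - w‖)) := by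
          rw [ENNReal.ofReal_mul k.coe_nonneg, ENNReal.ofReal_coe_nnreal]
    rw [edist_dist, ENNReal.ofReal_le_ofReal_iff (by positivity), dist_eq_norm] at hdist
    have htri : ‖z - w‖ ≤ ‖(z + G z) - (w + G w)‖ + ‖G z - G w‖ := by
      calc ‖z - w‖ = ‖((z + G z) - (w + G w)) - (G z - G w)‖ := by congr 1; ring
        _ ≤ _ := norm_sub_le _ _
    linarith
  have hpos : 0 < 1 - k * M := by linarith
  refine ⟨fun z hz w hw hzw => ?_, ?_⟩
  · have h := hlower z hz w hw
    simp only at hzw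
    rw [hzw, sub_self, norm_zero] at h
    have : ‖z - w‖ ≤ 0 := nonpos_of_mul_nonpos_right h hpos
    exact sub_eq_zero.1 (norm_le_zero_iff.1 this)
  · rintro _ ⟨z, hz, rfl⟩ _ ⟨w, hw, rfl⟩
    obtain ⟨γ, hγc, hγ0, hγ1, hγΩ, hlen⟩ := hlin z hz w hw
    have hΦ : ∀ w ∈ Ω, HasDerivAt (fun w => w + G w) (1 + deriv G w) w := fun w hw =>
      (hasDerivAt_id w).add (hG w hw).hasDerivAt
    refine ⟨(fun w => w + G w) ∘ γ, ?_, by simp [hγ0], by simp [hγ1],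
      fun t ht => mem_image_of_mem _ (hγΩ t ht), ?_⟩
    · exact ContinuousOn.comp (fun w hw => (hΦ w hw).continuousAt.continuousWithinAt) hγc hγΩ
    have hvar := eVariationOn_comp_le_of_nnnorm_deriv_le (C := 1 + k) hΩ
      (fun w hw => (hΦ w hw).differentiableAt) (fun w hw => by
        rw [(hΦ w hw).deriv]
        refine (nnnorm_add_le _ _).trans ?_
        rw [nnnorm_one]
        gcongr
        exact hk w hw) zero_le_one hγc hγΩ
    calc _ ≤ ((1 + k : ℝ≥0) : ℝ≥0∞) * eVariationOn γ (Icc 0 1) := hvar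
      _ ≤ ((1 + k : ℝ≥0) : ℝ≥0∞) * ENNReal.ofReal (M * ‖z - w‖) := by gcongr
      _ = ENNReal.ofReal ((1 + k : ℝ≥0) * (M * ‖z - w‖)) := by
        rw [ENNReal.ofReal_mul (1 + k).coe_nonneg, ENNReal.ofReal_coe_nnreal]
      _ ≤ _ := by
        refine ENNReal.ofReal_le_ofReal ?_
        rw [div_mul_eq_mul_div, le_div_iff₀ hpos]
        have := mul_le_mul_of_nonneg_left (hlower z hz w hw)
          (by positivity : 0 ≤ (1 + k : ℝ) * M)
        push_cast
        linarith

/-- If `F = h - g` is univalent on the disk with `M*`-linearly connected image and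
`|g'| ≤ M₁|h'|` with `0 ≤ M₁ < 1/(1+M*)`, then `h` is univalent and `h(𝔻)` is
`(M*/(1 - M₁(1+M*)))`-linearly connected. -/
theorem h_univalent_of_shear_linearly_connected
    (h g : ℂ → ℂ) (Mstar M₁ : ℝ) (hMstar : 1 ≤ Mstar)
    (hM₁0 : 0 ≤ M₁) (hM₁ : M₁ < 1 / (1 + Mstar))
    (hh : DifferentiableOn ℂ h (ball (0 : ℂ) 1))
    (hg : DifferentiableOn ℂ g (ball (0 : ℂ) 1))
    (hFinj : Set.InjOn (fun z => h z - g z) (ball (0 : ℂ) 1))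
    (hFlin : LinearlyConnected ((fun z => h z - g z) '' ball (0 : ℂ) 1) Mstar)
    (hω : ∀ z ∈ ball (0 : ℂ) 1, ‖deriv g z‖ ≤ M₁ * ‖deriv h z‖) :
    Set.InjOn h (ball (0 : ℂ) 1) ∧
    LinearlyConnected (h '' ball (0 : ℂ) 1) (Mstar / (1 - M₁ * (1 + Mstar))) := by
  have hpos : 0 < 1 + Mstar := by linarith
  have hM₁' : M₁ * (1 + Mstar) < 1 := (lt_div_iff₀ hpos).1 hM₁
  have hM₁lt : 0 < 1 - M₁ := by nlinarith
  have hF : DifferentiableOn ℂ (fun z => h z - g z) (ball 0 1) := hh.sub hg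
  have hψ := hFinj.leftInvOn_invFunOn
  set F : ℂ → ℂ := fun z => h z - g z
  set ψ := Function.invFunOn F (ball 0 1)
  set k : ℝ≥0 := ⟨M₁ / (1 - M₁), by positivity⟩
  have hk : (k : ℝ) = M₁ / (1 - M₁) := rfl
  have hgψ : ∀ z ∈ ball (0 : ℂ) 1,
      HasDerivAt (g ∘ ψ) (deriv g z * (deriv F z)⁻¹) (F z) := fun z hz => by
    have hg' := (hg.differentiableAt (isOpen_ball.mem_nhds hz)).hasDerivAt
    rw [← hψ hz] at hg'
    have hcomp := hg'.comp (F z) (hasDerivAt_leftInverse isOpen_ball hF hψ hz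
      (deriv_ne_zero_of_injOn isOpen_ball hF hFinj hz))
    rwa [hψ hz] at hcomp
  have hbound : ∀ z ∈ ball (0 : ℂ) 1, ‖deriv g z * (deriv F z)⁻¹‖ ≤ M₁ / (1 - M₁) :=
    fun z hz => by
    have hF' : deriv F z = deriv h z - deriv g z :=
      deriv_sub (hh.differentiableAt (isOpen_ball.mem_nhds hz))
        (hg.differentiableAt (isOpen_ball.mem_nhds hz))
    have hF'pos : 0 < ‖deriv F z‖ :=
      norm_pos_iff.2 (deriv_ne_zero_of_injOn isOpen_ball hF hFinj hz)
    have htri : ‖deriv h z‖ - ‖deriv g z‖ ≤ ‖deriv F z‖ := hF' ▸ norm_sub_norm_le _ _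
    rw [norm_mul, norm_inv, ← div_eq_mul_inv, div_le_div_iff₀ hF'pos hM₁lt]
    nlinarith [hω z hz, mul_le_mul_of_nonneg_left htri hM₁0]
  have hkM : k * Mstar < 1 := by
    rw [hk, div_mul_eq_mul_div, div_lt_one hM₁lt]
    linarith
  obtain ⟨hinj, hlin⟩ := hFlin.injOn_id_add (k := k) (G := g ∘ ψ)
    (isOpen_image_of_injOn isOpen_ball hF hFinj) (by linarith)
    (by rintro _ ⟨z, hz, rfl⟩; exact (hgψ z hz).differentiableAt)
    (by
      rintro _ ⟨z, hz, rfl⟩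
      rw [(hgψ z hz).deriv]
      exact hbound z hz) hkM
  have hΦF : EqOn ((fun w => w + (g ∘ ψ) w) ∘ F) h (ball 0 1) := fun z hz => by
    change F z + g (ψ (F z)) = h z
    rw [hψ hz]
    exact sub_add_cancel _ _
  have hconst : (1 + k) * Mstar / (1 - k * Mstar) = Mstar / (1 - M₁ * (1 + Mstar)) := by
    have h₁ : 1 - k * Mstar = (1 - M₁ * (1 + Mstar)) / (1 - M₁) := by
      rw [hk]
      field_simp
      ring
    have h₂ : (1 : ℝ) + k = 1 / (1 - M₁) := by
      rw [hk]
      field_simp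
      ring
    have h₃ : 1 - M₁ * (1 + Mstar) ≠ 0 := by linarith
    rw [h₁, h₂]
    field_simp
  refine ⟨(hinj.comp hFinj (mapsTo_image _ _)).congr hΦF, ?_⟩
  rwa [← image_comp, hΦF.image_eq, hconst] at hlin
end

section
/- Fix α ∈ [0, 1). Let f = h + conj(g) be a harmonic mapping on the unit disk 𝔻 (h, g holomorphic on 𝔻). If h − g (or h + g) is α-close-to-convex and the dilatation ω = g'/h' satisfies |ω(z)| ≤ M₁ for all z ∈ 𝔻, where M₁ < cos(απ/2)/(1 + cos(απ/2)), then h is univalent on 𝔻 and h(𝔻) is an M₂-linearly connected domain, where M₂ = 1/(cos(απ/2) − M₁(1 + cos(απ/2))). -/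
open Complex Metric Set

/-- A univalent analytic function `f` on the unit disk is `α`-close-to-convex if there is
a univalent analytic function `φ` with convex range such that
`|arg(f'(z)/φ'(z))| ≤ απ/2` on the disk. -/
def IsCloseToConvex (α : ℝ) (f : ℂ → ℂ) : Prop :=
  DifferentiableOn ℂ f (ball (0 : ℂ) 1) ∧ Set.InjOn f (ball (0 : ℂ) 1) ∧
  ∃ φ : ℂ → ℂ, DifferentiableOn ℂ φ (ball (0 : ℂ) 1) ∧ Set.InjOn φ (ball (0 : ℂ) 1) ∧
    Convex ℝ (φ '' ball (0 : ℂ) 1) ∧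
    ∀ z ∈ ball (0 : ℂ) 1, |Complex.arg (deriv f z / deriv φ z)| ≤ α * Real.pi / 2

open Filter Topology in
/-- The inverse of an injective holomorphic function is holomorphic, and the derivative of such
a function does not vanish. -/
theorem hasDerivAt_invFunOn_of_injOn {f : ℂ → ℂ} {U : Set ℂ} (hU : IsOpen U)
    (hf : DifferentiableOn ℂ f U) (hinj : InjOn f U) {z : ℂ} (hz : z ∈ U) :
    HasDerivAt (Function.invFunOn f U) (deriv f z)⁻¹ (f z) := by
  set ψ := Function.invFunOn f U
  have hleft : ∀ x ∈ U, ψ (f x) = x := fun x hx => hinj.leftInvOn_invFunOn hx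
  have han : ∀ x ∈ U, AnalyticAt ℂ f x := fun x hx => hf.analyticAt (hU.mem_nhds hx)
  have hnotconst : ∀ x ∈ U, ¬ ∀ᶠ y in 𝓝 x, f y = f x := by
    intro x hx hc
    have : ∀ᶠ y in 𝓝[≠] x, False := by
      filter_upwards [hc.filter_mono nhdsWithin_le_nhds, self_mem_nhdsWithin,
        mem_nhdsWithin_of_mem_nhds (hU.mem_nhds hx)] with y h1 h2 h3
      exact h2 (hinj h3 hx h1)
    exact this.exists.elim fun _ h => h
  have hopen : ∀ x ∈ U, 𝓝 (f x) ≤ map f (𝓝 x) := fun x hx =>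
    (han x hx).eventually_constant_or_nhds_le_map_nhds.resolve_left (hnotconst x hx)
  have hcont : ∀ x ∈ U, Tendsto ψ (𝓝 (f x)) (𝓝 x) := by
    intro x hx
    refine Tendsto.mono_left ?_ (hopen x hx)
    rw [tendsto_map'_iff]
    refine tendsto_id.congr' ?_
    filter_upwards [hU.mem_nhds hx] with y hy using (hleft y hy).symm
  have hright : ∀ x ∈ U, ∀ᶠ w in 𝓝 (f x), ψ w ∈ U ∧ f (ψ w) = w := by
    intro x hx
    refine hopen x hx ?_
    rw [mem_map]
    filter_upwards [hU.mem_nhds hx] with y hy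
    simp [hleft y hy, hy]
  have hinv : ∀ x ∈ U, deriv f x ≠ 0 → HasDerivAt ψ (deriv f x)⁻¹ (f x) := by
    intro x hx h0
    have hcx : ContinuousAt ψ (f x) := by
      have := hcont x hx
      rwa [ContinuousAt, hleft x hx]
    refine HasDerivAt.of_local_left_inverse hcx ?_ h0 ((hright x hx).mono fun w hw => hw.2)
    rw [hleft x hx]
    exact (han x hx).differentiableAt.hasDerivAt
  have hne : ∀ᶠ y in 𝓝[≠] z, deriv f y ≠ 0 := by
    refine (han z hz).deriv.eventually_eq_zero_or_eventually_ne_zero.resolve_left fun h0 => ?_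
    refine hnotconst z hz ?_
    obtain ⟨r, hr, hball⟩ := Metric.eventually_nhds_iff_ball.1
      (h0.and (hU.mem_nhds hz : ∀ᶠ y in 𝓝 z, y ∈ U))
    filter_upwards [ball_mem_nhds z hr] with y hy
    refine isOpen_ball.is_const_of_deriv_eq_zero (convex_ball z r).isPreconnected
      (fun x hx => (han x (hball x hx).2).differentiableAt.differentiableWithinAt)
      (fun x hx => (hball x hx).1) hy (mem_ball_self hr)
  have hcz : ContinuousAt ψ (f z) := by
    have := hcont z hz
    rwa [ContinuousAt, hleft z hz]
  have hpunct : ∀ᶠ w in 𝓝[≠] (f z), DifferentiableAt ℂ ψ w := by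
    have ht : Tendsto ψ (𝓝[≠] (f z)) (𝓝[≠] z) := by
      refine tendsto_nhdsWithin_iff.2 ⟨(hcont z hz).mono_left nhdsWithin_le_nhds, ?_⟩
      filter_upwards [self_mem_nhdsWithin, (hright z hz).filter_mono nhdsWithin_le_nhds]
        with w h1 h2 h3
      exact h1 (by rw [mem_singleton_iff] at h3 ⊢; rw [← h2.2, h3])
    filter_upwards [ht.eventually hne, (hright z hz).filter_mono nhdsWithin_le_nhds] with w h1 h2
    have := (hinv _ h2.1 h1).differentiableAt
    rwa [h2.2] at this
  have hψd : DifferentiableAt ℂ ψ (f z) :=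
    (Complex.analyticAt_of_differentiable_on_punctured_nhds_of_continuousAt hpunct
      hcz).differentiableAt
  refine hinv z hz fun h0 => ?_
  have hcomp := hψd.hasDerivAt.comp z (han z hz).differentiableAt.hasDerivAt
  have hid : HasDerivAt (ψ ∘ f) 1 z := by
    refine (hasDerivAt_id z).congr_of_eventuallyEq ?_
    filter_upwards [hU.mem_nhds hz] with y hy using hleft y hy
  simpa [h0] using hcomp.unique hid

/-- A path whose increments are dominated by those of a real function `v` has length at most
the total increment of `v`. -/
theorem eVariationOn_Icc_le_of_dist_le {E : Type*} [PseudoMetricSpace E] {γ : ℝ → E} {v : ℝ → ℝ}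
    {a b : ℝ} (hab : a ≤ b)
    (hv : ∀ s ∈ Icc a b, ∀ t ∈ Icc a b, s ≤ t → dist (γ t) (γ s) ≤ v t - v s) :
    eVariationOn γ (Icc a b) ≤ ENNReal.ofReal (v b - v a) := by
  have hmono : MonotoneOn v (Icc a b) := fun s hs t ht hst =>
    sub_nonneg.1 (dist_nonneg.trans (hv s hs t ht hst))
  have hle : eVariationOn γ (Icc a b) ≤ eVariationOn v (Icc a b) := by
    refine iSup_le fun p => ?_
    refine le_trans (Finset.sum_le_sum fun i _ => ?_)
      (eVariationOn.sum_le p.2.2.1 (n := p.1) p.2.2.2)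
    rw [edist_dist, edist_dist, Real.dist_eq]
    exact ENNReal.ofReal_le_ofReal ((hv _ (p.2.2.2 _) _ (p.2.2.2 _)
      (p.2.2.1 (Nat.le_succ i))).trans (le_abs_self _))
  have := (hmono.eVariationOn_eq (left_mem_Icc.2 hab) (right_mem_Icc.2 hab)).le
  rw [inter_self] at this
  exact hle.trans this

/-- A path whose speed is at most `v'` has increments dominated by those of `v`. -/
theorem norm_sub_le_sub_of_norm_deriv_le {E : Type*} [NormedAddCommGroup E] [NormedSpace ℝ E]
    {γ γ' : ℝ → E} {v v' : ℝ → ℝ} {a b : ℝ}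
    (hγ : ∀ t ∈ Icc a b, HasDerivAt γ (γ' t) t) (hv : ∀ t ∈ Icc a b, HasDerivAt v (v' t) t)
    (hle : ∀ t ∈ Icc a b, ‖γ' t‖ ≤ v' t) {s t : ℝ} (hs : s ∈ Icc a b) (ht : t ∈ Icc a b)
    (hst : s ≤ t) : ‖γ t - γ s‖ ≤ v t - v s := by
  have hsub : ∀ x ∈ Icc s t, x ∈ Icc a b := fun x hx => ⟨hs.1.trans hx.1, hx.2.trans ht.2⟩
  refine image_norm_le_of_norm_deriv_right_le_deriv_boundary' (a := s) (b := t)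
    (f := fun x => γ x - γ s) (f' := γ') (B := fun x => v x - v s) (B' := v')
    ?_ ?_ (by simp) ?_ ?_ ?_ (right_mem_Icc.2 hst)
  · exact fun x hx => ((hγ x (hsub x hx)).sub_const _).continuousAt.continuousWithinAt
  · exact fun x hx => ((hγ x (hsub x (Ico_subset_Icc_self hx))).sub_const _).hasDerivWithinAt
  · exact fun x hx => ((hv x (hsub x hx)).sub_const _).continuousAt.continuousWithinAt
  · exact fun x hx => ((hv x (hsub x (Ico_subset_Icc_self hx))).sub_const _).hasDerivWithinAt
  · exact fun x hx => hle x (hsub x (Ico_subset_Icc_self hx))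

/-- A complex number with argument at most `θ ≤ π` in absolute value has real part at least
`cos θ` times its modulus. -/
theorem cos_mul_norm_le_re {w : ℂ} {θ : ℝ} (hθ : θ ≤ Real.pi) (hw : |Complex.arg w| ≤ θ) :
    Real.cos θ * ‖w‖ ≤ w.re := by
  rw [← Complex.norm_mul_cos_arg w, mul_comm, ← Real.cos_abs (Complex.arg w)]
  exact mul_le_mul_of_nonneg_left
    (Real.cos_le_cos_of_nonneg_of_le_pi (abs_nonneg _) hθ hw) (norm_nonneg _)

/-- If `h + g` is `α`-close-to-convex and `|g'| ≤ M₁ |h'|`, then any two points of the disk are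
joined by a curve whose image under `h` is short; the increment of `g` is controlled as well. -/
theorem exists_path_of_isCloseToConvex_add {α : ℝ} (hα0 : 0 ≤ α) (hα1 : α < 1) {h g : ℂ → ℂ}
    (hh : DifferentiableOn ℂ h (ball (0 : ℂ) 1)) (hg : DifferentiableOn ℂ g (ball (0 : ℂ) 1))
    (hctc : IsCloseToConvex α (fun z => h z + g z)) {M₁ : ℝ} (hM₁0 : 0 ≤ M₁)
    (hM₁ : M₁ < Real.cos (α * Real.pi / 2) / (1 + Real.cos (α * Real.pi / 2)))
    (hω : ∀ z ∈ ball (0 : ℂ) 1, ‖deriv g z‖ ≤ M₁ * ‖deriv h z‖)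
    {z w : ℂ} (hz : z ∈ ball (0 : ℂ) 1) (hw : w ∈ ball (0 : ℂ) 1) :
    ∃ (γ : ℝ → ℂ) (L : ℝ), ContinuousOn γ (Icc 0 1) ∧ γ 0 = h z ∧ γ 1 = h w ∧
      (∀ t ∈ Icc (0 : ℝ) 1, γ t ∈ h '' ball (0 : ℂ) 1) ∧
      eVariationOn γ (Icc 0 1) ≤ ENNReal.ofReal L ∧
      (Real.cos (α * Real.pi / 2) - M₁ * (1 + Real.cos (α * Real.pi / 2))) * L ≤ ‖h z - h w‖ ∧
      ‖g w - g z‖ ≤ M₁ * L := by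
  obtain ⟨-, -, φ, hφ, hφinj, hconv, harg⟩ := hctc
  set c := Real.cos (α * Real.pi / 2) with hc
  have hπ := Real.pi_pos
  have hc0 : 0 < c := Real.cos_pos_of_mem_Ioo ⟨by nlinarith, by nlinarith⟩
  have hM : M₁ * (1 + c) < c := (lt_div_iff₀ (by linarith)).1 hM₁
  have hM1 : M₁ < 1 := by nlinarith
  set U := ball (0 : ℂ) 1 with hU
  set ψ := Function.invFunOn φ U
  set d := φ w - φ z with hd
  let p : ℝ → ℂ := fun t => φ z + t * d
  have hp : ∀ t ∈ Icc (0 : ℝ) 1, p t ∈ φ '' U := by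
    intro t ht
    have := hconv.add_smul_sub_mem (mem_image_of_mem φ hz) (mem_image_of_mem φ hw) ht
    simpa [p, hd] using this
  have hψU : ∀ t ∈ Icc (0 : ℝ) 1, ψ (p t) ∈ U := fun t ht => Function.invFunOn_mem (hp t ht)
  have hψφ : ∀ t ∈ Icc (0 : ℝ) 1, φ (ψ (p t)) = p t := fun t ht =>
    Function.invFunOn_eq (hp t ht)
  have hpd : ∀ t : ℝ, HasDerivAt p d t := by
    intro t
    have := ((Complex.ofRealCLM.hasDerivAt (x := t)).mul_const d).const_add (φ z)
    simpa [p] using this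
  have hpath : ∀ t ∈ Icc (0 : ℝ) 1,
      HasDerivAt (fun t => ψ (p t)) ((deriv φ (ψ (p t)))⁻¹ * d) t := by
    intro t ht
    have h1 := hasDerivAt_invFunOn_of_injOn isOpen_ball hφ hφinj (hψU t ht)
    rw [hψφ t ht] at h1
    exact HasDerivAt.comp t h1 (hpd t)
  have hcomp : ∀ {k : ℂ → ℂ}, DifferentiableOn ℂ k U → ∀ t ∈ Icc (0 : ℝ) 1,
      HasDerivAt (fun t => k (ψ (p t)))
        (deriv k (ψ (p t)) * ((deriv φ (ψ (p t)))⁻¹ * d)) t := by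
    intro k hk t ht
    exact HasDerivAt.comp t
      (hk.differentiableAt (isOpen_ball.mem_nhds (hψU t ht))).hasDerivAt (hpath t ht)
  have hψ0 : ψ (p 0) = z := by simpa [p] using hφinj.leftInvOn_invFunOn hz
  have hψ1 : ψ (p 1) = w := by simpa [p, hd] using hφinj.leftInvOn_invFunOn hw
  -- the component of `h + g` in the direction of `d` along the curve
  set e : ℂ := (starRingEnd ℂ) d / ‖d‖ with he
  have hde : d * e = ‖d‖ := by
    rcases eq_or_ne d 0 with h0 | h0
    · simp [h0]
    · have : (‖d‖ : ℂ) ≠ 0 := by simpa using h0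
      rw [he, ← mul_div_assoc, Complex.mul_conj, Complex.normSq_eq_norm_sq]
      field_simp
      push_cast; ring
  have henorm : ‖e‖ ≤ 1 := by
    rw [he, norm_div, RCLike.norm_conj]
    simpa using div_self_le_one ‖d‖
  let u : ℝ → ℝ := fun t => ((h (ψ (p t)) + g (ψ (p t))) * e).re
  let q : ℝ → ℂ := fun t =>
    (deriv h (ψ (p t)) + deriv g (ψ (p t))) / deriv φ (ψ (p t))
  have hu : ∀ t ∈ Icc (0 : ℝ) 1, HasDerivAt u ((q t).re * ‖d‖) t := by
    intro t ht
    have h1 := ((hcomp hh t ht).add (hcomp hg t ht)).mul_const e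
    have h2 := Complex.reCLM.hasFDerivAt.comp_hasDerivAt t h1
    refine h2.congr_deriv ?_
    have : (deriv h (ψ (p t)) * ((deriv φ (ψ (p t)))⁻¹ * d) +
        deriv g (ψ (p t)) * ((deriv φ (ψ (p t)))⁻¹ * d)) * e = q t * (‖d‖ : ℝ) := by
      rw [← hde]; simp only [q]; ring
    rw [this, Complex.reCLM_apply, Complex.re_mul_ofReal]
  have hq : ∀ t ∈ Icc (0 : ℝ) 1,
      c * (1 - M₁) * ‖deriv h (ψ (p t)) * ((deriv φ (ψ (p t)))⁻¹ * d)‖ ≤ (q t).re * ‖d‖ := by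
    intro t ht
    have hx := hψU t ht
    have hnhds := isOpen_ball.mem_nhds hx
    have h1 := harg _ hx
    rw [deriv_fun_add (hh.differentiableAt hnhds) (hg.differentiableAt hnhds)] at h1
    have h2 := cos_mul_norm_le_re (by nlinarith) h1
    have h3 : (1 - M₁) * ‖deriv h (ψ (p t))‖ ≤ ‖deriv h (ψ (p t)) + deriv g (ψ (p t))‖ := by
      have := norm_sub_le (deriv h (ψ (p t)) + deriv g (ψ (p t))) (deriv g (ψ (p t)))
      rw [add_sub_cancel_right] at this
      have := hω _ hx
      linarith
    calc c * (1 - M₁) * ‖deriv h (ψ (p t)) * ((deriv φ (ψ (p t)))⁻¹ * d)‖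
        = c * (((1 - M₁) * ‖deriv h (ψ (p t))‖) * ‖deriv φ (ψ (p t))‖⁻¹) * ‖d‖ := by
          rw [norm_mul, norm_mul, norm_inv]; ring
      _ ≤ c * (‖deriv h (ψ (p t)) + deriv g (ψ (p t))‖ * ‖deriv φ (ψ (p t))‖⁻¹) * ‖d‖ := by
          gcongr
      _ = c * ‖q t‖ * ‖d‖ := by simp only [q]; rw [norm_div, div_eq_mul_inv]
      _ ≤ (q t).re * ‖d‖ := by gcongr
  have hK : 0 < c * (1 - M₁) := mul_pos hc0 (by linarith)
  let v : ℝ → ℝ := fun t => u t / (c * (1 - M₁))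
  have hv : ∀ t ∈ Icc (0 : ℝ) 1, HasDerivAt v ((q t).re * ‖d‖ / (c * (1 - M₁))) t :=
    fun t ht => (hu t ht).div_const _
  have hhle : ∀ t ∈ Icc (0 : ℝ) 1,
      ‖deriv h (ψ (p t)) * ((deriv φ (ψ (p t)))⁻¹ * d)‖ ≤ (q t).re * ‖d‖ / (c * (1 - M₁)) := by
    intro t ht
    rw [le_div_iff₀ hK, mul_comm]
    exact hq t ht
  have hgle : ∀ t ∈ Icc (0 : ℝ) 1,
      ‖deriv g (ψ (p t)) * ((deriv φ (ψ (p t)))⁻¹ * d)‖ ≤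
        M₁ * ((q t).re * ‖d‖ / (c * (1 - M₁))) := by
    intro t ht
    refine le_trans ?_ (mul_le_mul_of_nonneg_left (hhle t ht) hM₁0)
    rw [norm_mul, norm_mul (deriv h _), ← mul_assoc]
    exact mul_le_mul_of_nonneg_right (hω _ (hψU t ht)) (norm_nonneg _)
  have h01 : (0 : ℝ) ∈ Icc (0 : ℝ) 1 := by simp
  have h11 : (1 : ℝ) ∈ Icc (0 : ℝ) 1 := by simp
  have hgL : ‖g w - g z‖ ≤ M₁ * (v 1 - v 0) := by
    have := norm_sub_le_sub_of_norm_deriv_le (hcomp hg) (fun t ht => (hv t ht).const_mul M₁) hgle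
      h01 h11 zero_le_one
    simp only [hψ0, hψ1] at this
    linarith
  refine ⟨fun t => h (ψ (p t)), v 1 - v 0,
    fun t ht => (hcomp hh t ht).continuousAt.continuousWithinAt, by simp only [hψ0],
    by simp only [hψ1], fun t ht => mem_image_of_mem h (hψU t ht), ?_, ?_, hgL⟩
  · refine eVariationOn_Icc_le_of_dist_le zero_le_one fun s hs t ht hst => ?_
    rw [dist_eq_norm]
    exact norm_sub_le_sub_of_norm_deriv_le (hcomp hh) hv hhle hs ht hst
  · have hu01 : u 1 - u 0 ≤ ‖h z - h w‖ + ‖g w - g z‖ := by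
      have h1 : u 1 - u 0 = (((h w - h z) + (g w - g z)) * e).re := by
        simp only [u, hψ0, hψ1]
        rw [← Complex.sub_re]; congr 1; ring
      calc u 1 - u 0 ≤ ‖((h w - h z) + (g w - g z)) * e‖ := h1 ▸ Complex.re_le_norm _
        _ ≤ ‖(h w - h z) + (g w - g z)‖ := by
          rw [norm_mul]; exact mul_le_of_le_one_right (norm_nonneg _) henorm
        _ ≤ ‖h z - h w‖ + ‖g w - g z‖ := by
          rw [norm_sub_rev (h z)]; exact norm_add_le _ _
    have hvu : c * (1 - M₁) * (v 1 - v 0) = u 1 - u 0 := by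
      simp only [v]; rw [← sub_div, mul_div_cancel₀ _ hK.ne']
    linarith

/-- The theorem in the case where `h + g` is `α`-close-to-convex. -/
theorem injOn_and_linearlyConnected_of_isCloseToConvex_add {α : ℝ} (hα0 : 0 ≤ α) (hα1 : α < 1)
    {h g : ℂ → ℂ} (hh : DifferentiableOn ℂ h (ball (0 : ℂ) 1))
    (hg : DifferentiableOn ℂ g (ball (0 : ℂ) 1))
    (hctc : IsCloseToConvex α (fun z => h z + g z)) {M₁ : ℝ} (hM₁0 : 0 ≤ M₁)
    (hM₁ : M₁ < Real.cos (α * Real.pi / 2) / (1 + Real.cos (α * Real.pi / 2)))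
    (hω : ∀ z ∈ ball (0 : ℂ) 1, ‖deriv g z‖ ≤ M₁ * ‖deriv h z‖) :
    InjOn h (ball (0 : ℂ) 1) ∧
    LinearlyConnected (h '' ball (0 : ℂ) 1)
      (1 / (Real.cos (α * Real.pi / 2) - M₁ * (1 + Real.cos (α * Real.pi / 2)))) := by
  have hπ := Real.pi_pos
  have hc0 : 0 < Real.cos (α * Real.pi / 2) :=
    Real.cos_pos_of_mem_Ioo ⟨by nlinarith, by nlinarith⟩
  have hpos : 0 < Real.cos (α * Real.pi / 2) - M₁ * (1 + Real.cos (α * Real.pi / 2)) :=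
    sub_pos.2 ((lt_div_iff₀ (by linarith)).1 hM₁)
  constructor
  · intro z hz w hw hzw
    obtain ⟨-, L, -, -, -, -, -, hL, hgL⟩ :=
      exists_path_of_isCloseToConvex_add hα0 hα1 hh hg hctc hM₁0 hM₁ hω hz hw
    rw [hzw, sub_self, norm_zero] at hL
    have hL0 : L ≤ 0 := nonpos_of_mul_nonpos_right hL hpos
    have hgzw : g w = g z := sub_eq_zero.1 (norm_le_zero_iff.1
      (hgL.trans (mul_nonpos_of_nonneg_of_nonpos hM₁0 hL0)))
    exact hctc.2.1 hz hw (by simp only [hzw, hgzw])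
  · rintro _ ⟨z, hz, rfl⟩ _ ⟨w, hw, rfl⟩
    obtain ⟨γ, L, hγ, h0, h1, hmem, hvar, hL, -⟩ :=
      exists_path_of_isCloseToConvex_add hα0 hα1 hh hg hctc hM₁0 hM₁ hω hz hw
    refine ⟨γ, hγ, h0, h1, hmem, hvar.trans (ENNReal.ofReal_le_ofReal ?_)⟩
    rw [one_div, ← div_eq_inv_mul, le_div_iff₀ hpos, mul_comm]
    exact hL

/-- If `h - g` (or `h + g`) is `α`-close-to-convex and the dilatation of `f = h + conj g`
is bounded by `M₁ < cos(απ/2)/(1 + cos(απ/2))`, then `h` is univalent and `h(𝔻)` is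
`M₂`-linearly connected with `M₂ = 1/(cos(απ/2) - M₁(1 + cos(απ/2)))`. -/
theorem h_univalent_of_close_to_convex
    (α : ℝ) (hα0 : 0 ≤ α) (hα1 : α < 1)
    (h g : ℂ → ℂ)
    (hh : DifferentiableOn ℂ h (ball (0 : ℂ) 1))
    (hg : DifferentiableOn ℂ g (ball (0 : ℂ) 1))
    (hctc : IsCloseToConvex α (fun z => h z - g z) ∨
            IsCloseToConvex α (fun z => h z + g z))
    (M₁ : ℝ) (hM₁0 : 0 ≤ M₁)
    (hM₁ : M₁ < Real.cos (α * Real.pi / 2) / (1 + Real.cos (α * Real.pi / 2)))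
    (hω : ∀ z ∈ ball (0 : ℂ) 1, ‖deriv g z‖ ≤ M₁ * ‖deriv h z‖) :
    Set.InjOn h (ball (0 : ℂ) 1) ∧
    LinearlyConnected (h '' ball (0 : ℂ) 1)
      (1 / (Real.cos (α * Real.pi / 2) - M₁ * (1 + Real.cos (α * Real.pi / 2)))) := by
  rcases hctc with hctc | hctc
  · refine injOn_and_linearlyConnected_of_isCloseToConvex_add hα0 hα1 hh hg.neg ?_ hM₁0 hM₁ ?_
    · simpa only [Pi.neg_apply, ← sub_eq_add_neg] using hctc
    · intro z hz
      rw [deriv.neg, norm_neg]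
      exact hω z hz
  · exact injOn_and_linearlyConnected_of_isCloseToConvex_add hα0 hα1 hh hg hctc hM₁0 hM₁ hω
end

section
/- Fix α ∈ [0, 1). Let f = h + conj(g) be a harmonic mapping on the unit disk 𝔻 (h, g holomorphic on 𝔻). If h − g (or h + g) is α-close-to-convex and the dilatation ω = g'/h' satisfies |ω(z)| ≤ M₃ for all z ∈ 𝔻, where M₃ < cos(απ/2)/(2 + cos(απ/2)), then for every θ ∈ [0, 2π), the harmonic mapping f_θ = h + e^{iθ}·conj(g) is univalent on 𝔻, satisfies Λ_{f_θ}(z) ≤ K·λ_{f_θ}(z) for all z ∈ 𝔻 with K = (1 + M₃)/(1 − M₃) (i.e., f_θ is a K-quasiconformal harmonic mapping), and f_θ(𝔻) is an M₄-linearly connected domain, where M₄ = (1 + M₃)/(cos(απ/2) − M₃(2 + cos(απ/2))). -/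
open Complex Metric Set ComplexConjugate

open Filter Topology

/-- A holomorphic function which is injective near a point has nonzero derivative there. -/
theorem AnalyticAt.deriv_ne_zero_of_injOn {φ : ℂ → ℂ} {a : ℂ} {s : Set ℂ}
    (hφ : AnalyticAt ℂ φ a) (hs : s ∈ 𝓝 a) (hinj : InjOn φ s) : deriv φ a ≠ 0 := by
  have hnc : ¬ ∀ᶠ z in 𝓝 a, φ z = φ a := by
    intro hc
    obtain ⟨z, ⟨hz, hzs⟩, hza⟩ :=
      (((hc.and hs).filter_mono nhdsWithin_le_nhds).and
        (self_mem_nhdsWithin (s := {a}ᶜ))).exists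
    exact hza (hinj hzs (mem_of_mem_nhds hs) hz)
  have hopen : 𝓝 (φ a) ≤ map φ (𝓝 a) :=
    hφ.eventually_constant_or_nhds_le_map_nhds.resolve_left hnc
  set ψ : ℂ → ℂ := Function.invFunOn φ s
  have hψ : ∀ᶠ z in 𝓝 a, ψ (φ z) = z := by
    filter_upwards [hs] with z hz using hinj.leftInvOn_invFunOn hz
  have hcont : ContinuousAt ψ (φ a) := by
    have : Tendsto (ψ ∘ φ) (𝓝 a) (𝓝 a) := tendsto_id.congr' (hψ.mono fun z hz => hz.symm)
    simpa [ContinuousAt, hψ.self_of_nhds] using (tendsto_map'_iff.2 this).mono_left hopen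
  have hne : ∀ᶠ z in 𝓝[≠] a, deriv φ z ≠ 0 := by
    refine hφ.deriv.eventually_eq_zero_or_eventually_ne_zero.resolve_left fun h0 => hnc ?_
    obtain ⟨r, hr, hball⟩ := Metric.eventually_nhds_iff_ball.1
      (h0.and hφ.eventually_analyticAt)
    filter_upwards [ball_mem_nhds a hr] with z hz
    refine (convex_ball a r).is_const_of_fderivWithin_eq_zero (𝕜 := ℂ)
      (fun w hw => (hball w hw).2.differentiableAt.differentiableWithinAt)
      (fun w hw => ?_) hz (mem_ball_self hr)
    rw [fderivWithin_of_isOpen isOpen_ball hw]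
    ext
    simpa using (hball w hw).1
  have hdiff : ∀ᶠ w in 𝓝[≠] φ a, DifferentiableAt ℂ ψ w := by
    rw [eventually_nhdsWithin_iff] at hne ⊢
    refine hopen (mem_map.2 ?_)
    filter_upwards [hne, hψ.eventually_nhds, hφ.eventually_analyticAt] with z hz hψz hφz hza
    exact (hφz.hasStrictDerivAt.to_local_left_inverse
      (hz fun h => hza (by rw [mem_singleton_iff.1 h]; rfl)) hψz).hasDerivAt.differentiableAt
  have hψd : DifferentiableAt ℂ ψ (φ a) :=
    (analyticAt_of_differentiable_on_punctured_nhds_of_continuousAt hdiff hcont).differentiableAt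
  intro h0
  have hcomp := hψd.hasDerivAt.comp a hφ.differentiableAt.hasDerivAt
  have hid : HasDerivAt (ψ ∘ φ) 1 a := (hasDerivAt_id a).congr_of_eventuallyEq hψ
  simpa [h0] using hcomp.unique hid

/-- A curve whose speed is controlled by the speed of its projection in a fixed direction is
controlled by its chord. -/
theorem eVariationOn_le_of_norm_deriv_le_re {γ γ' : ℝ → ℂ} {e : ℂ} {K : ℝ} (he : ‖e‖ ≤ 1)
    (hK : 0 ≤ K) (hγ : ∀ t ∈ Icc (0 : ℝ) 1, HasDerivAt γ (γ' t) t)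
    (hle : ∀ t ∈ Icc (0 : ℝ) 1, ‖γ' t‖ ≤ K * (e * γ' t).re) :
    eVariationOn γ (Icc 0 1) ≤ ENNReal.ofReal (K * ‖γ 0 - γ 1‖) := by
  set u : ℝ → ℝ := fun t => K * (e * γ t).re
  have hu : ∀ t ∈ Icc (0 : ℝ) 1, HasDerivAt u (K * (e * γ' t).re) t := fun t ht => by
    have h1 : HasDerivAt (fun t => e * γ t) (e * γ' t) t := (hγ t ht).const_mul e
    exact (reCLM.hasFDerivAt.comp_hasDerivAt t h1).const_mul K
  have key : ∀ s ∈ Icc (0 : ℝ) 1, ∀ t ∈ Icc (0 : ℝ) 1, s ≤ t → ‖γ t - γ s‖ ≤ u t - u s := by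
    intro s hs t ht hst
    have hsub : ∀ x ∈ Icc s t, x ∈ Icc (0 : ℝ) 1 := fun x hx =>
      ⟨hs.1.trans hx.1, hx.2.trans ht.2⟩
    have hγs : ∀ x ∈ Icc s t, HasDerivAt (fun x => γ x - γ s) (γ' x) x := fun x hx =>
      (hγ x (hsub x hx)).sub_const _
    have hus : ∀ x ∈ Icc s t, HasDerivAt (fun x => u x - u s) (K * (e * γ' x).re) x :=
      fun x hx => (hu x (hsub x hx)).sub_const _
    exact image_norm_le_of_norm_deriv_right_le_deriv_boundary'
      (fun x hx => (hγs x hx).continuousAt.continuousWithinAt)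
      (fun x hx => (hγs x (Ico_subset_Icc_self hx)).hasDerivWithinAt)
      (by simp)
      (fun x hx => (hus x hx).continuousAt.continuousWithinAt)
      (fun x hx => (hus x (Ico_subset_Icc_self hx)).hasDerivWithinAt)
      (fun x hx => hle x (hsub x (Ico_subset_Icc_self hx))) (right_mem_Icc.2 hst)
  have hmono : MonotoneOn u (Icc 0 1) := fun s hs t ht hst =>
    sub_nonneg.1 ((norm_nonneg _).trans (key s hs t ht hst))
  calc eVariationOn γ (Icc 0 1) ≤ eVariationOn u (Icc 0 1) := by
        refine iSup_le fun p => le_trans (Finset.sum_le_sum fun i _ => ?_)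
          (eVariationOn.sum_le (n := p.1) p.2.2.1 p.2.2.2)
        rw [edist_dist, edist_dist, dist_eq_norm, Real.dist_eq]
        exact ENNReal.ofReal_le_ofReal ((key _ (p.2.2.2 i) _ (p.2.2.2 (i + 1))
          (p.2.2.1 i.le_succ)).trans (le_abs_self _))
    _ ≤ ENNReal.ofReal (u 1 - u 0) := by
        simpa using (hmono.eVariationOn_eq (left_mem_Icc.2 zero_le_one)
          (right_mem_Icc.2 zero_le_one)).le
    _ ≤ ENNReal.ofReal (K * ‖γ 0 - γ 1‖) := by
        refine ENNReal.ofReal_le_ofReal ?_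
        have h1 : u 1 - u 0 = K * (e * (γ 1 - γ 0)).re := by
          simp only [u, mul_sub, sub_re]
        rw [h1, norm_sub_rev]
        refine mul_le_mul_of_nonneg_left ((re_le_norm _).trans ?_) hK
        rw [norm_mul]
        exact mul_le_of_le_one_left (norm_nonneg _) he

/-- Any two points of a domain on which `φ` is univalent with convex range are joined by the
preimage of a segment. -/
theorem exists_path_of_injOn_of_convex_image {φ : ℂ → ℂ} {U : Set ℂ} (hU : IsOpen U)
    (hφ : DifferentiableOn ℂ φ U) (hinj : InjOn φ U) (hconv : Convex ℝ (φ '' U))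
    {z w : ℂ} (hz : z ∈ U) (hw : w ∈ U) :
    ∃ ζ : ℝ → ℂ, ζ 0 = z ∧ ζ 1 = w ∧ ∀ t ∈ Icc (0 : ℝ) 1,
      ζ t ∈ U ∧ HasDerivAt ζ ((φ w - φ z) / deriv φ (ζ t)) t := by
  set ψ : ℂ → ℂ := Function.invFunOn φ U
  have hψ : ∀ x ∈ U, ψ (φ x) = x := hinj.leftInvOn_invFunOn
  set l : ℝ → ℂ := fun t => φ z + t * (φ w - φ z)
  have hl : ∀ t, HasDerivAt l (φ w - φ z) t := fun t => by
    have := ((ofRealCLM.hasDerivAt (x := t)).mul_const (φ w - φ z)).const_add (φ z)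
    rwa [ofRealCLM_apply, ofReal_one, one_mul] at this
  refine ⟨ψ ∘ l, by simp [l, hψ z hz], by simp [l, hψ w hw], fun t ht => ?_⟩
  obtain ⟨x, hx, hxl⟩ : l t ∈ φ '' U := by
    simpa [l] using hconv.add_smul_sub_mem (mem_image_of_mem φ hz) (mem_image_of_mem φ hw) ht
  have hlx : (ψ ∘ l) t = x := by simp [← hxl, hψ x hx]
  have han : AnalyticAt ℂ φ x := hφ.analyticAt (hU.mem_nhds hx)
  have hinv : HasDerivAt ψ (deriv φ x)⁻¹ (l t) := hxl ▸
    (han.hasStrictDerivAt.to_local_left_inverse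
      (han.deriv_ne_zero_of_injOn (hU.mem_nhds hx) hinj)
      (by filter_upwards [hU.mem_nhds hx] with y hy using hψ y hy)).hasDerivAt
  rw [hlx]
  exact ⟨hx, by simpa [div_eq_inv_mul] using hinv.comp t (hl t)⟩

/-- A complex number in a sector has real part comparable to its modulus. -/
theorem cos_mul_norm_le_re_of_abs_arg_le {p : ℂ} {β : ℝ} (hβ : β ≤ Real.pi)
    (hp : |arg p| ≤ β) : Real.cos β * ‖p‖ ≤ p.re := by
  rw [← norm_mul_cos_arg p, mul_comm, ← Real.cos_abs (arg p)]
  exact mul_le_mul_of_nonneg_left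
    (Real.cos_le_cos_of_nonneg_of_le_pi (abs_nonneg _) hβ hp) (norm_nonneg _)

/-- The distortion estimate for the derivative of a shear in the direction of `D`. -/
theorem shear_distortion {k q σ ε D : ℂ} {c M : ℝ} (hσ : ‖σ‖ = 1) (hε : ‖ε‖ = 1) (hD : D ≠ 0)
    (hc : 0 < c) (hM0 : 0 ≤ M) (hM : 0 < c - M * (2 + c))
    (hq : ‖q‖ ≤ M * ‖k‖) (hp : c * ‖k - σ * q‖ ≤ (k - σ * q).re) :
    ‖k * D + ε * conj (q * D)‖ ≤
      (1 + M) / (c - M * (2 + c)) * (conj D / ‖D‖ * (k * D + ε * conj (q * D))).re := by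
  have hD' : (0 : ℝ) < ‖D‖ := norm_pos_iff.2 hD
  have hup : ‖k * D + ε * conj (q * D)‖ ≤ ‖D‖ * (‖k‖ + ‖q‖) := by
    refine (norm_add_le _ _).trans_eq ?_
    simp only [norm_mul, RCLike.norm_conj, hε]
    ring
  have hlow : ‖D‖ * (c * ‖k - σ * q‖ - 2 * ‖q‖) ≤
      (conj D / ‖D‖ * (k * D + ε * conj (q * D))).re := by
    have hexp : conj D / ‖D‖ * (k * D + ε * conj (q * D)) =
        (‖D‖ : ℂ) * (k - σ * q) + (‖D‖ * (σ * q) + conj D / ‖D‖ * (ε * conj (q * D))) := by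
      have h1 : conj D / ‖D‖ * D = ‖D‖ := by
        rw [div_mul_eq_mul_div, conj_mul', div_eq_iff (by exact_mod_cast hD'.ne'), sq]
      linear_combination k * h1
    have hrest : ‖‖D‖ * (σ * q) + conj D / ‖D‖ * (ε * conj (q * D))‖ ≤ ‖D‖ * (2 * ‖q‖) := by
      refine (norm_add_le _ _).trans_eq ?_
      simp only [norm_mul, norm_div, RCLike.norm_conj, hε, hσ, norm_real, norm_norm]
      field_simp
      ring
    have hrest' := (abs_le.1 ((abs_re_le_norm _).trans hrest)).1
    rw [hexp, add_re, re_ofReal_mul]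
    nlinarith [mul_le_mul_of_nonneg_left hp hD'.le]
  have hk : ‖k‖ ≤ ‖k - σ * q‖ + ‖q‖ := by
    have := norm_add_le (k - σ * q) (σ * q)
    rwa [sub_add_cancel, norm_mul, hσ, one_mul] at this
  have hmain : (‖k‖ + ‖q‖) * (c - M * (2 + c)) ≤ (1 + M) * (c * ‖k - σ * q‖ - 2 * ‖q‖) := by
    have h1 : ‖k‖ * (c - M * (2 + c)) ≤ c * ‖k - σ * q‖ - 2 * ‖q‖ := by nlinarith
    nlinarith
  rw [div_mul_eq_mul_div, le_div_iff₀ hM]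
  calc ‖k * D + ε * conj (q * D)‖ * (c - M * (2 + c))
      ≤ ‖D‖ * (‖k‖ + ‖q‖) * (c - M * (2 + c)) := mul_le_mul_of_nonneg_right hup hM.le
    _ ≤ (1 + M) * (‖D‖ * (c * ‖k - σ * q‖ - 2 * ‖q‖)) := by nlinarith
    _ ≤ _ := mul_le_mul_of_nonneg_left hlow (by linarith)

/-- Distinct points of the disk have distinct images under `h + ε * conj g` which are joined by a
short path in the range, when `h - σ * g` is close-to-convex and the dilatation is small. -/
theorem shear_ne_and_exists_path {α M : ℝ} {h g : ℂ → ℂ} {σ ε : ℂ}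
    (hα0 : 0 ≤ α) (hα1 : α < 1)
    (hh : DifferentiableOn ℂ h (ball (0 : ℂ) 1)) (hg : DifferentiableOn ℂ g (ball (0 : ℂ) 1))
    (hσ : ‖σ‖ = 1) (hε : ‖ε‖ = 1) (hctc : IsCloseToConvex α (fun z => h z - σ * g z))
    (hM0 : 0 ≤ M)
    (hM : 0 < Real.cos (α * Real.pi / 2) - M * (2 + Real.cos (α * Real.pi / 2)))
    (hω : ∀ z ∈ ball (0 : ℂ) 1, ‖deriv g z‖ ≤ M * ‖deriv h z‖)
    {z w : ℂ} (hz : z ∈ ball (0 : ℂ) 1) (hw : w ∈ ball (0 : ℂ) 1) (hzw : z ≠ w) :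
    h z + ε * conj (g z) ≠ h w + ε * conj (g w) ∧
    ∃ γ : ℝ → ℂ, ContinuousOn γ (Icc 0 1) ∧ γ 0 = h z + ε * conj (g z) ∧
      γ 1 = h w + ε * conj (g w) ∧
      (∀ t ∈ Icc (0 : ℝ) 1, γ t ∈ (fun z => h z + ε * conj (g z)) '' ball (0 : ℂ) 1) ∧
      eVariationOn γ (Icc 0 1) ≤ ENNReal.ofReal ((1 + M) /
        (Real.cos (α * Real.pi / 2) - M * (2 + Real.cos (α * Real.pi / 2))) *
        ‖h z + ε * conj (g z) - (h w + ε * conj (g w))‖) := by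
  obtain ⟨hF, hFinj, φ, hφ, hφinj, hconv, harg⟩ := hctc
  set c := Real.cos (α * Real.pi / 2)
  have hc : 0 < c := Real.cos_pos_of_mem_Ioo
    ⟨by nlinarith [Real.pi_pos], by nlinarith [Real.pi_pos]⟩
  obtain ⟨ζ, hζ0, hζ1, hζ⟩ :=
    exists_path_of_injOn_of_convex_image isOpen_ball hφ hφinj hconv hz hw
  set D := φ w - φ z
  have hD : D ≠ 0 := sub_ne_zero.2 fun hφzw => hzw (hφinj hz hw hφzw.symm)
  set e : ℂ := conj D / ‖D‖
  have he : ‖e‖ ≤ 1 := by simp [e, div_self (norm_ne_zero_iff.2 hD)]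
  set γ : ℝ → ℂ := fun t => h (ζ t) + ε * conj (g (ζ t))
  set γ' : ℝ → ℂ := fun t => deriv h (ζ t) / deriv φ (ζ t) * D +
    ε * conj (deriv g (ζ t) / deriv φ (ζ t) * D)
  have hγ : ∀ t ∈ Icc (0 : ℝ) 1, HasDerivAt γ (γ' t) t := fun t ht => by
    obtain ⟨hζt, hζd⟩ := hζ t ht
    have hmem := isOpen_ball.mem_nhds hζt
    have h1 := (hh.differentiableAt hmem).hasDerivAt.comp t hζd
    have h2 := (hg.differentiableAt hmem).hasDerivAt.comp t hζd
    have h3 := h1.add (h2.star.const_mul ε)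
    refine h3.congr_deriv ?_
    simp only [γ', starRingEnd_apply, mul_div_assoc', div_mul_eq_mul_div]
  have hdF : ∀ x ∈ ball (0 : ℂ) 1,
      deriv (fun z => h z - σ * g z) x = deriv h x - σ * deriv g x := fun x hx => by
    have hmem := isOpen_ball.mem_nhds hx
    exact ((hh.differentiableAt hmem).hasDerivAt.sub
      ((hg.differentiableAt hmem).hasDerivAt.const_mul σ)).deriv
  have hle : ∀ t ∈ Icc (0 : ℝ) 1, ‖γ' t‖ ≤ (1 + M) / (c - M * (2 + c)) * (e * γ' t).re := by
    intro t ht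
    have hx := (hζ t ht).1
    refine shear_distortion hσ hε hD hc hM0 hM ?_ ?_
    · rw [norm_div, norm_div, ← mul_div_assoc]
      exact div_le_div_of_nonneg_right (hω _ hx) (norm_nonneg _)
    · rw [← mul_div_assoc, ← sub_div, ← hdF _ hx]
      exact cos_mul_norm_le_re_of_abs_arg_le (by nlinarith [Real.pi_pos]) (harg _ hx)
  have hγ'0 : ∀ t ∈ Icc (0 : ℝ) 1, γ' t ≠ 0 := by
    intro t ht h0
    have hx := (hζ t ht).1
    have hmem := isOpen_ball.mem_nhds hx
    have hφ0 := (hφ.analyticAt hmem).deriv_ne_zero_of_injOn hmem hφinj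
    have hF0 := (hF.analyticAt hmem).deriv_ne_zero_of_injOn hmem hFinj
    have hM1 : M < 1 := by nlinarith
    have hnorm : ‖deriv h (ζ t)‖ = ‖deriv g (ζ t)‖ := by
      have := congrArg norm (eq_neg_of_add_eq_zero_left h0)
      simp only [norm_mul, norm_div, norm_neg, RCLike.norm_conj, hε, one_mul] at this
      have hφn := norm_ne_zero_iff.2 hφ0
      have hDn := norm_ne_zero_iff.2 hD
      field_simp at this
      exact this
    have hh0 : ‖deriv h (ζ t)‖ = 0 := by
      nlinarith [hω _ hx, norm_nonneg (deriv h (ζ t))]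
    refine hF0 ?_
    simp [hdF _ hx, norm_eq_zero.1 hh0, norm_eq_zero.1 (hnorm.symm.trans hh0)]
  have hK : 0 < (1 + M) / (c - M * (2 + c)) := by positivity
  have hγ0 : γ 0 = h z + ε * conj (g z) := by simp [γ, hζ0]
  have hγ1 : γ 1 = h w + ε * conj (g w) := by simp [γ, hζ1]
  have hcont : ContinuousOn γ (Icc 0 1) := fun t ht =>
    (hγ t ht).continuousAt.continuousWithinAt
  refine ⟨?_, γ, hcont, hγ0, hγ1, fun t ht => ⟨ζ t, (hζ t ht).1, rfl⟩, ?_⟩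
  · rw [← hγ0, ← hγ1]
    have hu : ∀ t ∈ Icc (0 : ℝ) 1, HasDerivAt (fun t => (e * γ t).re) (e * γ' t).re t :=
      fun t ht => reCLM.hasFDerivAt.comp_hasDerivAt t ((hγ t ht).const_mul e)
    have hmono : StrictMonoOn (fun t => (e * γ t).re) (Icc 0 1) := by
      refine strictMonoOn_of_deriv_pos (convex_Icc 0 1)
        (fun t ht => (hu t ht).continuousAt.continuousWithinAt) fun t ht => ?_
      have ht' := interior_subset ht
      rw [(hu t ht').deriv]
      exact pos_of_mul_pos_right ((norm_pos_iff.2 (hγ'0 t ht')).trans_le (hle t ht')) hK.le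
    intro heq
    have := hmono (left_mem_Icc.2 zero_le_one) (right_mem_Icc.2 zero_le_one) zero_lt_one
    simp [heq] at this
  · rw [← hγ0, ← hγ1]
    exact eVariationOn_le_of_norm_deriv_le_re he hK.le hγ hle

/-- If `h - g` (or `h + g`) is `α`-close-to-convex and the dilatation of `f = h + conj g`
is bounded by `M₃ < cos(απ/2)/(2 + cos(απ/2))`, then for every `θ ∈ [0,2π)` the mapping
`f_θ = h + e^{iθ}·conj g` is univalent, `K`-quasiconformal with `K = (1+M₃)/(1-M₃)`, and
`f_θ(𝔻)` is `M₄`-linearly connected with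
`M₄ = (1+M₃)/(cos(απ/2) - M₃(2 + cos(απ/2)))`. -/
theorem shear_close_to_convex_quasiconformal
    (α : ℝ) (hα0 : 0 ≤ α) (hα1 : α < 1)
    (h g : ℂ → ℂ)
    (hh : DifferentiableOn ℂ h (ball (0 : ℂ) 1))
    (hg : DifferentiableOn ℂ g (ball (0 : ℂ) 1))
    (hctc : IsCloseToConvex α (fun z => h z - g z) ∨
            IsCloseToConvex α (fun z => h z + g z))
    (M₃ : ℝ) (hM₃0 : 0 ≤ M₃)
    (hM₃ : M₃ < Real.cos (α * Real.pi / 2) / (2 + Real.cos (α * Real.pi / 2)))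
    (hω : ∀ z ∈ ball (0 : ℂ) 1, ‖deriv g z‖ ≤ M₃ * ‖deriv h z‖) :
    ∀ θ ∈ Ico (0 : ℝ) (2 * Real.pi),
      Set.InjOn (fun z => h z + Complex.exp (θ * Complex.I) * conj (g z))
        (ball (0 : ℂ) 1) ∧
      (∀ z ∈ ball (0 : ℂ) 1,
        ‖deriv h z‖ + ‖deriv g z‖ ≤
          (1 + M₃) / (1 - M₃) * |‖deriv h z‖ - ‖deriv g z‖|) ∧
      LinearlyConnected
        ((fun z => h z + Complex.exp (θ * Complex.I) * conj (g z)) '' ball (0 : ℂ) 1)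
        ((1 + M₃) /
          (Real.cos (α * Real.pi / 2) - M₃ * (2 + Real.cos (α * Real.pi / 2)))) := by
  intro θ _
  have hc : 0 < Real.cos (α * Real.pi / 2) := Real.cos_pos_of_mem_Ioo
    ⟨by nlinarith [Real.pi_pos], by nlinarith [Real.pi_pos]⟩
  have hM : 0 < Real.cos (α * Real.pi / 2) - M₃ * (2 + Real.cos (α * Real.pi / 2)) := by
    rw [lt_div_iff₀ (by linarith)] at hM₃
    linarith
  have hM1 : M₃ < 1 := by nlinarith
  have hε : ‖Complex.exp (θ * Complex.I)‖ = 1 := norm_exp_ofReal_mul_I θ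
  obtain ⟨σ, hσ, hctc⟩ : ∃ σ : ℂ, ‖σ‖ = 1 ∧ IsCloseToConvex α (fun z => h z - σ * g z) := by
    rcases hctc with hctc | hctc
    · exact ⟨1, by simp, by simpa using hctc⟩
    · exact ⟨-1, by simp, by simpa using hctc⟩
  have main := fun {z w : ℂ} => shear_ne_and_exists_path (z := z) (w := w)
    hα0 hα1 hh hg hσ hε hctc hM₃0 hM hω
  refine ⟨fun z hz w hw heq => ?_, fun z hz => ?_, ?_⟩
  · by_contra hzw
    exact (main hz hw hzw).1 heq
  · rw [div_mul_eq_mul_div, le_div_iff₀ (by linarith)]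
    nlinarith [le_abs_self (‖deriv h z‖ - ‖deriv g z‖), hω z hz]
  · rintro _ ⟨z, hz, rfl⟩ _ ⟨w, hw, rfl⟩
    rcases eq_or_ne z w with rfl | hzw
    · refine ⟨fun _ => h z + Complex.exp (θ * Complex.I) * conj (g z), continuousOn_const,
        rfl, rfl, fun _ _ => ⟨z, hz, rfl⟩, ?_⟩
      rw [eVariationOn.constant_on (subsingleton_singleton.anti (by rintro _ ⟨_, _, rfl⟩; rfl))]
      exact zero_le
    · exact (main hz hw hzw).2
end
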